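/- Let X = ℝⁿ, n ≥ 2, with κ the α-Riesz kernel of order α ∈ (0, n) with α ≤ 2. Let A ⊆ ℝⁿ be such that E⁺(A) is closed in the strong metric d, with cap_*(A) = ∞ and cap_*(A) > 0, and let f := −U^ζ where ζ ∈ E⁺ and ζ(ℝⁿ) ≤ 1. Then the solution λ_{A,f} of the inner Gauss variational problem for (A, f) exists if and only if ζ^A(ℝⁿ) = 1, and in the affirmative case λ_{A,f} = ζ^A. -/

import Mathlib

open MeasureTheory Topology Filter Set ENNReal

noncomputable section

namespace GaussVar

variable {X : Type*} [TopologicalSpace X] [MeasurableSpace X]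

/-- A (positive) Radon measure: a regular Borel measure. -/
def IsRadon (μ : Measure X) : Prop := μ.Regular

/-- The mutual energy `I(μ,ν) = ∬ κ(x,y) d(μ⊗ν)(x,y)`. -/
def mutualEnergy (κ : X → X → ℝ≥0∞) (μ ν : Measure X) : ℝ≥0∞ :=
  ∫⁻ p : X × X, κ p.1 p.2 ∂(μ.prod ν)

/-- The energy `I(μ) := I(μ,μ)`. -/
def energy (κ : X → X → ℝ≥0∞) (μ : Measure X) : ℝ≥0∞ := mutualEnergy κ μ μ

/-- Membership in the cone `E⁺` of Radon measures with finite energy. -/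
def memEplus (κ : X → X → ℝ≥0∞) (μ : Measure X) : Prop :=
  IsRadon μ ∧ energy κ μ < ⊤

/-- A kernel: symmetric and lower semicontinuous with values in `[0,∞]`. -/
def IsKernel (κ : X → X → ℝ≥0∞) : Prop :=
  (∀ x y, κ x y = κ y x) ∧ LowerSemicontinuous (fun p : X × X => κ p.1 p.2)

/-- The strong (energy) metric `d(μ,ν) := (I(μ)+I(ν)−2I(μ,ν))^{1/2}` on `E⁺`. -/
def strongDist (κ : X → X → ℝ≥0∞) (μ ν : Measure X) : ℝ :=
  Real.sqrt ((energy κ μ).toReal + (energy κ ν).toReal - 2 * (mutualEnergy κ μ ν).toReal)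

/-- The energy principle (strict positive definiteness). -/
def EnergyPrinciple (κ : X → X → ℝ≥0∞) : Prop :=
  ∀ μ ν : Measure X, memEplus κ μ → memEplus κ ν →
    2 * mutualEnergy κ μ ν ≤ energy κ μ + energy κ ν ∧
      (2 * mutualEnergy κ μ ν = energy κ μ + energy κ ν → μ = ν)

/-- Convergence of a sequence in the strong metric. -/
def StrongTendstoSeq (κ : X → X → ℝ≥0∞) (μ : ℕ → Measure X) (μ₀ : Measure X) : Prop :=
  Tendsto (fun n => strongDist κ (μ n) μ₀) atTop (𝓝 0)

/-- Vague convergence of a sequence of measures. -/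
def VagueTendstoSeq (μ : ℕ → Measure X) (μ₀ : Measure X) : Prop :=
  ∀ φ : X → ℝ, Continuous φ → HasCompactSupport φ →
    Tendsto (fun n => ∫ x, φ x ∂(μ n)) atTop (𝓝 (∫ x, φ x ∂μ₀))

/-- Cauchy sequence in the strong metric. -/
def StrongCauchySeq (κ : X → X → ℝ≥0∞) (μ : ℕ → Measure X) : Prop :=
  ∀ ε : ℝ, 0 < ε → ∃ N : ℕ, ∀ m ≥ N, ∀ n ≥ N, strongDist κ (μ m) (μ n) < ε

/-- A perfect kernel: satisfies the energy principle, `(E⁺,d)` is complete, and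
strong convergence implies vague convergence. -/
def IsPerfect (κ : X → X → ℝ≥0∞) : Prop :=
  EnergyPrinciple κ ∧
    (∀ μ : ℕ → Measure X, (∀ n, memEplus κ (μ n)) → StrongCauchySeq κ μ →
        ∃ μ₀ : Measure X, memEplus κ μ₀ ∧ StrongTendstoSeq κ μ μ₀) ∧
    (∀ (μ : ℕ → Measure X) (μ₀ : Measure X), (∀ n, memEplus κ (μ n)) → memEplus κ μ₀ →
        StrongTendstoSeq κ μ μ₀ → VagueTendstoSeq μ μ₀)

/-- `μ` is concentrated on `A`: the complement of `A` is locally `μ`-negligible. -/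
def Concentrated (μ : Measure X) (A : Set X) : Prop :=
  ∀ K : Set X, IsCompact K → μ (Aᶜ ∩ K) = 0

/-- Membership in `Ĕ⁺(A)`: finite-energy Radon measures concentrated on `A`
of unit total mass. -/
def memBreve (κ : X → X → ℝ≥0∞) (A : Set X) (μ : Measure X) : Prop :=
  memEplus κ μ ∧ Concentrated μ A ∧ μ Set.univ = 1

/-- `w(A) := inf { I(μ) : μ ∈ Ĕ⁺(A) }` (with `inf ∅ = ⊤`). -/
def wcap (κ : X → X → ℝ≥0∞) (A : Set X) : ℝ≥0∞ :=
  ⨅ (μ : Measure X) (_ : memBreve κ A μ), energy κ μ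

/-- The inner capacity `cap_*(A) := 1 / w(A)`. -/
def innerCap (κ : X → X → ℝ≥0∞) (A : Set X) : ℝ≥0∞ := (wcap κ A)⁻¹

/-- The outer capacity `cap^*(E) := inf { cap_*(D) : D open, E ⊆ D }`. -/
def outerCap (κ : X → X → ℝ≥0∞) (E : Set X) : ℝ≥0∞ :=
  ⨅ (D : Set X) (_ : IsOpen D ∧ E ⊆ D), innerCap κ D

/-- `P` holds nearly everywhere (n.e.) on `A`: the exceptional subset of `A`
has inner capacity zero. -/
def NearlyEverywhere (κ : X → X → ℝ≥0∞) (A : Set X) (P : X → Prop) : Prop :=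
  innerCap κ {x ∈ A | ¬ P x} = 0

/-- The potential `U^μ(x) := ∫ κ(x,y) dμ(y)`. -/
def potential (κ : X → X → ℝ≥0∞) (μ : Measure X) (x : X) : ℝ≥0∞ :=
  ∫⁻ y, κ x y ∂μ

/-- An external field: `f = ψ + U^{ϑ⁺} − U^{ϑ⁻}` where `ψ` is lower semicontinuous,
`(−∞,∞]`-valued, positive if `X` is noncompact, and `ϑ⁺, ϑ⁻ ∈ E⁺`. -/
def IsExternalField (κ : X → X → ℝ≥0∞) (f : X → EReal) : Prop :=
  ∃ (ψ : X → EReal) (ϑp ϑm : Measure X),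
    LowerSemicontinuous ψ ∧ (∀ x, ψ x ≠ ⊥) ∧ (¬ CompactSpace X → ∀ x, 0 ≤ ψ x) ∧
    memEplus κ ϑp ∧ memEplus κ ϑm ∧
    ∀ x, f x = ψ x + (potential κ ϑp x : EReal) - (potential κ ϑm x : EReal)

/-- `f` is `μ`-integrable (as an extended-real-valued function). -/
def FieldIntegrable (f : X → EReal) (μ : Measure X) : Prop :=
  Integrable (fun x => (f x).toReal) μ ∧ (∀ᵐ x ∂μ, f x ≠ ⊤ ∧ f x ≠ ⊥)

/-- `∫ f dμ` for an a.e.-finite integrable field. -/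
def fieldIntegral (f : X → EReal) (μ : Measure X) : ℝ := ∫ x, (f x).toReal ∂μ

/-- The Gauss functional `I_f(μ) := I(μ) + 2 ∫ f dμ`. -/
def gaussI (κ : X → X → ℝ≥0∞) (f : X → EReal) (μ : Measure X) : ℝ :=
  (energy κ μ).toReal + 2 * fieldIntegral f μ

/-- Membership in `Ĕ⁺_f(A)`. -/
def Admissible (κ : X → X → ℝ≥0∞) (A : Set X) (f : X → EReal) (μ : Measure X) : Prop :=
  memBreve κ A μ ∧ FieldIntegrable f μ

/-- `w_f(A) := inf { I_f(μ) : μ ∈ Ĕ⁺_f(A) }` (with `inf ∅ = ⊤`). -/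
def wf (κ : X → X → ℝ≥0∞) (A : Set X) (f : X → EReal) : EReal :=
  ⨅ (μ : Measure X) (_ : Admissible κ A f μ), ((gaussI κ f μ : ℝ) : EReal)

/-- `l` is a solution of the inner Gauss variational problem for `(A,f)`. -/
def IsSolution (κ : X → X → ℝ≥0∞) (A : Set X) (f : X → EReal) (l : Measure X) : Prop :=
  Admissible κ A f l ∧ ((gaussI κ f l : ℝ) : EReal) = wf κ A f

/-- The `f`-weighted potential `U_f^μ := U^μ + f`. -/
def wPotential (κ : X → X → ℝ≥0∞) (f : X → EReal) (μ : Measure X) (x : X) : EReal :=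
  (potential κ μ x : EReal) + f x

/-- `∫ U_f^μ dμ`, the weighted equilibrium constant of a solution. -/
def wConst (κ : X → X → ℝ≥0∞) (f : X → EReal) (μ : Measure X) : ℝ :=
  ∫ x, (wPotential κ f μ x).toReal ∂μ

/-- The cone `E⁺(A)` is closed in the strong metric. -/
def StrongClosedEplusOn (κ : X → X → ℝ≥0∞) (A : Set X) : Prop :=
  ∀ (μ : ℕ → Measure X) (μ₀ : Measure X),
    (∀ n, memEplus κ (μ n) ∧ Concentrated (μ n) A) →
    memEplus κ μ₀ → StrongTendstoSeq κ μ μ₀ → Concentrated μ₀ A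

/-- Frostman's (first) maximum principle. -/
def FrostmanMax (κ : X → X → ℝ≥0∞) : Prop :=
  ∀ μ : Measure X, memEplus κ μ →
    (∀ x : X, (∀ U : Set X, IsOpen U → x ∈ U → 0 < μ U) → potential κ μ x ≤ 1) →
    ∀ x : X, potential κ μ x ≤ 1

/-- The domination (second maximum) principle. -/
def DominationPrinciple (κ : X → X → ℝ≥0∞) : Prop :=
  ∀ μ ν : Measure X, memEplus κ μ → memEplus κ ν →
    (∀ᵐ x ∂μ, potential κ μ x ≤ potential κ ν x) →
    ∀ x : X, potential κ μ x ≤ potential κ ν x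

/-- `β` is the inner balayage of `ζ` onto `A`: `β ∈ E⁺(A)` and `U^β = U^ζ` n.e. on `A`. -/
def IsInnerBalayage (κ : X → X → ℝ≥0∞) (A : Set X) (ζ β : Measure X) : Prop :=
  memEplus κ β ∧ Concentrated β A ∧
    NearlyEverywhere κ A (fun x => potential κ β x = potential κ ζ x)

/-- `γ` is the inner capacitary measure of `A`: `γ ∈ E⁺(A)` and `U^γ = 1` n.e. on `A`. -/
def IsCapacitaryMeasure (κ : X → X → ℝ≥0∞) (A : Set X) (γ : Measure X) : Prop :=
  memEplus κ γ ∧ Concentrated γ A ∧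
    NearlyEverywhere κ A (fun x => potential κ γ x = 1)

/-- `A` is quasiclosed: approximable in outer capacity by closed sets. -/
def Quasiclosed (κ : X → X → ℝ≥0∞) (A : Set X) : Prop :=
  ∀ ε : ℝ≥0∞, 0 < ε → ∃ F : Set X, IsClosed F ∧ outerCap κ (symmDiff A F) < ε

/-- `A` is quasicompact: approximable in outer capacity by compact sets. -/
def Quasicompact (κ : X → X → ℝ≥0∞) (A : Set X) : Prop :=
  ∀ ε : ℝ≥0∞, 0 < ε → ∃ K : Set X, IsCompact K ∧ outerCap κ (symmDiff A K) < ε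


/-- Euclidean space `ℝⁿ`. -/
abbrev Rn (n : ℕ) := EuclideanSpace ℝ (Fin n)

/-- The α-Riesz kernel `|x−y|^(α−n)` on `ℝⁿ` (with value `∞` on the diagonal). -/
def rieszKernel (n : ℕ) (α : ℝ) : Rn n → Rn n → ℝ≥0∞ :=
  fun x y => (ENNReal.ofReal (dist x y)) ^ (α - (n : ℝ))

/-- `B` is inner α-thin at infinity. -/
def InnerThinAtInfinity (n : ℕ) (α : ℝ) (B : Set (Rn n)) : Prop :=
  ∃ q : ℝ, 1 < q ∧
    (∑' k : ℕ, innerCap (rieszKernel n α)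
        (B ∩ {x : Rn n | q ^ k ≤ ‖x‖ ∧ ‖x‖ < q ^ (k + 1)}) /
      ENNReal.ofReal (q ^ ((k : ℝ) * ((n : ℝ) - α)))) ≠ ⊤

/-- The Gaussian heat kernel on `ℝⁿ` at time `t`. -/
def heat (n : ℕ) (t : ℝ) (x y : Rn n) : ℝ≥0∞ :=
  ENNReal.ofReal ((4 * Real.pi * t) ^ (-(n : ℝ) / 2) * Real.exp (-(1 / (4 * t)) * ‖x - y‖ ^ 2))

lemma heat_symm (n : ℕ) (t : ℝ) (x y : Rn n) : heat n t x y = heat n t y x := by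
  simp only [heat, norm_sub_rev x y]

lemma heat_lt_top (n : ℕ) (t : ℝ) (x y : Rn n) : heat n t x y < ⊤ := ENNReal.ofReal_lt_top

lemma measurable_heat (n : ℕ) :
    Measurable fun p : ℝ × Rn n × Rn n => heat n p.1 p.2.1 p.2.2 := by
  unfold heat
  fun_prop

lemma lintegral_gaussian (n : ℕ) {b : ℝ} (hb : 0 < b) :
    ∫⁻ y : Rn n, ENNReal.ofReal (Real.exp (-b * ‖y‖ ^ 2))
      = ENNReal.ofReal ((Real.pi / b) ^ ((n : ℝ) / 2)) := by
  have h := GaussianFourier.integral_rexp_neg_mul_sq_norm (V := Rn n) hb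
  rw [finrank_euclideanSpace_fin] at h
  rw [← h, ofReal_integral_eq_lintegral_ofReal]
  · by_contra hi
    rw [integral_undef hi] at h
    have : 0 < (Real.pi / b) ^ ((n : ℝ) / 2) := by positivity
    linarith
  · exact Filter.Eventually.of_forall fun _ => (Real.exp_pos _).le

lemma lintegral_gaussian_sub (n : ℕ) {b : ℝ} (hb : 0 < b) (x : Rn n) :
    ∫⁻ y : Rn n, ENNReal.ofReal (Real.exp (-b * ‖y - x‖ ^ 2))
      = ENNReal.ofReal ((Real.pi / b) ^ ((n : ℝ) / 2)) := by
  rw [← lintegral_gaussian n hb]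
  exact lintegral_sub_right_eq_self (fun y : Rn n => ENNReal.ofReal (Real.exp (-b * ‖y‖ ^ 2))) x

lemma lintegral_heat (n : ℕ) {t : ℝ} (ht : 0 < t) (x : Rn n) :
    ∫⁻ y, heat n t x y = 1 := by
  have hb : 0 < 1 / (4 * t) := by positivity
  have hp : 0 < 4 * Real.pi * t := by positivity
  simp_rw [heat, norm_sub_rev x]
  simp_rw [ENNReal.ofReal_mul (Real.rpow_nonneg hp.le _)]
  rw [lintegral_const_mul _ (by fun_prop), lintegral_gaussian_sub n hb,
    ← ENNReal.ofReal_mul (Real.rpow_nonneg hp.le _)]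
  have : Real.pi / (1 / (4 * t)) = 4 * Real.pi * t := by field_simp
  rw [this, ← Real.rpow_add hp]
  norm_num [neg_div]

lemma gaussian_complete_square (n : ℕ) {s t : ℝ} (hs : 0 < s) (ht : 0 < t) (x y z : Rn n) :
    (1 / (4 * s)) * ‖x - y‖ ^ 2 + (1 / (4 * t)) * ‖y - z‖ ^ 2
      = (1 / (4 * (s + t))) * ‖x - z‖ ^ 2
        + ((s + t) / (4 * s * t)) * ‖y - ((t / (s + t)) • x + (s / (s + t)) • z)‖ ^ 2 := by
  have hst : s + t ≠ 0 := by positivity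
  have e1 : x - z = (x - y) + (y - z) := by abel
  have e2 : y - ((t / (s + t)) • x + (s / (s + t)) • z)
      = (s / (s + t)) • (y - z) - (t / (s + t)) • (x - y) := by
    have : y = (t / (s + t)) • y + (s / (s + t)) • y := by
      rw [← add_smul, ← add_div, add_comm t s, div_self hst, one_smul]
    nth_rewrite 1 [this]
    module
  rw [e1, e2]
  generalize x - y = u
  generalize y - z = v
  rw [norm_add_sq_real, norm_sub_sq_real, norm_smul, norm_smul, mul_pow, mul_pow,
    real_inner_smul_left, real_inner_smul_right, real_inner_comm]
  simp only [Real.norm_eq_abs, sq_abs]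
  field_simp
  ring

lemma lintegral_heat_mul_heat (n : ℕ) {s t : ℝ} (hs : 0 < s) (ht : 0 < t) (x z : Rn n) :
    ∫⁻ y, heat n s x y * heat n t y z = heat n (s + t) x z := by
  have hst : 0 < s + t := by positivity
  have hb : 0 < (s + t) / (4 * s * t) := by positivity
  have hp : 0 < 4 * Real.pi * s := by positivity
  have hq : 0 < 4 * Real.pi * t := by positivity
  have key : ∀ y, heat n s x y * heat n t y z
      = ENNReal.ofReal ((4 * Real.pi * s) ^ (-(n : ℝ) / 2) * (4 * Real.pi * t) ^ (-(n : ℝ) / 2) *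
          Real.exp (-(1 / (4 * (s + t))) * ‖x - z‖ ^ 2)) *
        ENNReal.ofReal (Real.exp (-((s + t) / (4 * s * t)) *
          ‖y - ((t / (s + t)) • x + (s / (s + t)) • z)‖ ^ 2)) := by
    intro y
    rw [heat, heat, ← ENNReal.ofReal_mul (by positivity), ← ENNReal.ofReal_mul (by positivity)]
    congr 1
    rw [mul_mul_mul_comm, ← Real.exp_add, mul_assoc _ (Real.exp _), ← Real.exp_add]
    congr 2
    linarith [gaussian_complete_square n hs ht x y z]
  simp_rw [key]
  rw [lintegral_const_mul _ (by fun_prop), lintegral_gaussian_sub n hb,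
    ← ENNReal.ofReal_mul (by positivity), heat]
  congr 1
  rw [mul_right_comm]
  congr 1
  have h2 : (Real.pi / ((s + t) / (4 * s * t))) ^ ((n : ℝ) / 2)
      = (((s + t) / (4 * Real.pi * s * t))) ^ (-(n : ℝ) / 2) := by
    rw [neg_div, Real.rpow_neg (by positivity), ← Real.inv_rpow (by positivity)]
    congr 1
    field_simp
  rw [h2, ← Real.mul_rpow (by positivity) (by positivity),
    ← Real.mul_rpow (by positivity) (by positivity)]
  congr 1
  field_simp

/-- The mixture of heat kernels with time distributed according to `m`. -/
def heatMix (n : ℕ) (m : Measure ℝ) (x y : Rn n) : ℝ≥0∞ := ∫⁻ t, heat n t x y ∂m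

lemma heatMix_symm (n : ℕ) (m : Measure ℝ) (x y : Rn n) : heatMix n m x y = heatMix n m y x := by
  simp only [heatMix, heat_symm n _ x y]

lemma measurable_heatMix (n : ℕ) (m : Measure ℝ) [SFinite m] :
    Measurable fun p : Rn n × Rn n => heatMix n m p.1 p.2 := by
  unfold heatMix
  refine Measurable.lintegral_prod_right' (f := fun q : (Rn n × Rn n) × ℝ =>
    heat n q.2 q.1.1 q.1.2) ?_
  exact (measurable_heat n).comp (measurable_snd.prodMk measurable_fst)

lemma measurable_heat_left (n : ℕ) (y : Rn n) :
    Measurable fun p : ℝ × Rn n => heat n p.1 p.2 y :=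
  (measurable_heat n).comp (measurable_fst.prodMk (measurable_snd.prodMk measurable_const))

lemma measurable_heat_right (n : ℕ) (x : Rn n) :
    Measurable fun p : ℝ × Rn n => heat n p.1 x p.2 :=
  (measurable_heat n).comp (measurable_fst.prodMk (measurable_const.prodMk measurable_snd))

lemma measurable_heat_time (n : ℕ) (x y : Rn n) : Measurable fun t => heat n t x y :=
  (measurable_heat_left n y).comp (measurable_id.prodMk measurable_const)

lemma measurable_heatMix_left (n : ℕ) (m : Measure ℝ) [SFinite m] (y : Rn n) :
    Measurable fun x => heatMix n m x y := by
  unfold heatMix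
  exact Measurable.lintegral_prod_right' (f := fun q : Rn n × ℝ => heat n q.2 q.1 y)
    ((measurable_heat_left n y).comp measurable_swap)

lemma measurable_heatMix_right (n : ℕ) (m : Measure ℝ) [SFinite m] (x : Rn n) :
    Measurable fun y => heatMix n m x y := by
  unfold heatMix
  exact Measurable.lintegral_prod_right' (f := fun q : Rn n × ℝ => heat n q.2 x q.1)
    ((measurable_heat_right n x).comp measurable_swap)

lemma lintegral_heatMix (n : ℕ) (m : Measure ℝ) [SFinite m] (hm : ∀ᵐ t ∂m, 0 < t) (x : Rn n) :
    ∫⁻ y, heatMix n m x y = m univ := by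
  unfold heatMix
  have h : Measurable (Function.uncurry fun (y : Rn n) (t : ℝ) => heat n t x y) :=
    (measurable_heat_right n x).comp measurable_swap
  rw [lintegral_lintegral_swap h.aemeasurable]
  rw [lintegral_congr_ae (g := fun _ => 1)]
  · simp
  · filter_upwards [hm] with t ht using lintegral_heat n ht x

lemma lintegral_heatMix_mul_heatMix (n : ℕ) (m m' : Measure ℝ) [SFinite m] [SFinite m']
    (hm : ∀ᵐ t ∂m, 0 < t) (hm' : ∀ᵐ t ∂m', 0 < t) (x z : Rn n) :
    ∫⁻ y, heatMix n m x y * heatMix n m' y z = heatMix n (m ∗ m') x z := by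
  have h1 : ∀ y, heatMix n m x y * heatMix n m' y z
      = ∫⁻ s, ∫⁻ t, heat n s x y * heat n t y z ∂m' ∂m := by
    intro y
    rw [heatMix, heatMix, lintegral_lintegral_mul
      (measurable_heat_time n x y).aemeasurable (measurable_heat_time n y z).aemeasurable]
  simp_rw [h1]
  have hmeas : Measurable fun p : (Rn n × ℝ) × ℝ => heat n p.1.2 x p.1.1 * heat n p.2 p.1.1 z :=
    ((measurable_heat_right n x).comp
      ((measurable_snd.comp measurable_fst).prodMk (measurable_fst.comp measurable_fst))).mul
    ((measurable_heat_left n z).comp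
      (measurable_snd.prodMk (measurable_fst.comp measurable_fst)))
  rw [lintegral_lintegral_swap (hmeas.lintegral_prod_right' (ν := m')).aemeasurable,
    heatMix, Measure.lintegral_conv (measurable_heat_time n x z)]
  refine lintegral_congr_ae ?_
  filter_upwards [hm] with s hs
  rw [lintegral_lintegral_swap]
  · refine lintegral_congr_ae ?_
    filter_upwards [hm'] with t ht
    exact lintegral_heat_mul_heat n hs ht x z
  · exact (hmeas.comp ((measurable_fst.prodMk measurable_const).prodMk
      measurable_snd)).aemeasurable

lemma measurable_potential_heatMix (n : ℕ) (m : Measure ℝ) [SFinite m] (μ : Measure (Rn n))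
    [SFinite μ] : Measurable (potential (heatMix n m) μ) :=
  (measurable_heatMix n m).lintegral_prod_right'

lemma potential_conv (n : ℕ) (m m' : Measure ℝ) [SFinite m] [SFinite m']
    (hm : ∀ᵐ t ∂m, 0 < t) (hm' : ∀ᵐ t ∂m', 0 < t) (μ : Measure (Rn n)) [SFinite μ] (x : Rn n) :
    potential (heatMix n (m ∗ m')) μ x
      = ∫⁻ y, heatMix n m x y * potential (heatMix n m') μ y := by
  unfold potential
  simp_rw [← lintegral_heatMix_mul_heatMix n m m' hm hm' x]
  rw [lintegral_lintegral_swap]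
  · refine lintegral_congr fun y => ?_
    rw [lintegral_const_mul _ (measurable_heatMix_right n m' y)]
  · exact (((measurable_heatMix_right n m x).comp measurable_snd).mul
      ((measurable_heatMix n m').comp measurable_swap)).aemeasurable

lemma mutualEnergy_eq_lintegral_potential (n : ℕ) (m : Measure ℝ) [SFinite m]
    (μ ν : Measure (Rn n)) [SFinite μ] [SFinite ν] :
    mutualEnergy (heatMix n m) μ ν = ∫⁻ x, potential (heatMix n m) ν x ∂μ := by
  unfold mutualEnergy potential
  exact lintegral_prod _ (measurable_heatMix n m).aemeasurable

lemma mutualEnergy_comm (n : ℕ) (m : Measure ℝ) [SFinite m]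
    (μ ν : Measure (Rn n)) [SFinite μ] [SFinite ν] :
    mutualEnergy (heatMix n m) μ ν = mutualEnergy (heatMix n m) ν μ := by
  unfold mutualEnergy
  rw [← lintegral_prod_swap]
  exact lintegral_congr fun p => heatMix_symm n m _ _

/-- Duality: `∫ (K f) dμ = ∫ f U^μ dx`. -/
lemma lintegral_lintegral_heatMix_mul (n : ℕ) (m : Measure ℝ) [SFinite m] (μ : Measure (Rn n))
    [SFinite μ] {f : Rn n → ℝ≥0∞} (hf : Measurable f) :
    ∫⁻ x, (∫⁻ y, heatMix n m x y * f y) ∂μ = ∫⁻ y, f y * potential (heatMix n m) μ y := by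
  rw [lintegral_lintegral_swap]
  · refine lintegral_congr fun y => ?_
    rw [lintegral_mul_const _ (measurable_heatMix_left n m y), mul_comm, potential]
    simp_rw [heatMix_symm n m y]
  · exact ((measurable_heatMix n m).mul (hf.comp measurable_snd)).aemeasurable

lemma mutualEnergy_conv (n : ℕ) (m m' : Measure ℝ) [SFinite m] [SFinite m']
    (hm : ∀ᵐ t ∂m, 0 < t) (hm' : ∀ᵐ t ∂m', 0 < t) (μ ν : Measure (Rn n)) [SFinite μ] [SFinite ν] :
    mutualEnergy (heatMix n (m ∗ m')) μ ν
      = ∫⁻ y, potential (heatMix n m) μ y * potential (heatMix n m') ν y := by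
  rw [mutualEnergy_eq_lintegral_potential]
  simp_rw [potential_conv n m m' hm hm' ν]
  rw [lintegral_lintegral_heatMix_mul n m μ (measurable_potential_heatMix n m' ν)]
  exact lintegral_congr fun y => mul_comm _ _

lemma heatMix_dirac (n : ℕ) (t : ℝ) (x y : Rn n) :
    heatMix n (Measure.dirac t) x y = heat n t x y :=
  lintegral_dirac' t (measurable_heat_time n x y)

lemma ae_pos_dirac {t : ℝ} (ht : 0 < t) : ∀ᵐ s ∂(Measure.dirac t), 0 < s := by
  rw [ae_dirac_iff measurableSet_Ioi]
  exact ht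

/-- The mutual energy of `μ` and `ν` with respect to the heat kernel at time `t`. -/
def heatEnergy (n : ℕ) (μ ν : Measure (Rn n)) (t : ℝ) : ℝ≥0∞ :=
  mutualEnergy (heatMix n (Measure.dirac t)) μ ν

lemma heatEnergy_eq (n : ℕ) (μ ν : Measure (Rn n)) (t : ℝ) :
    heatEnergy n μ ν t = ∫⁻ p : Rn n × Rn n, heat n t p.1 p.2 ∂(μ.prod ν) := by
  simp only [heatEnergy, mutualEnergy, heatMix_dirac]

lemma measurable_heatEnergy (n : ℕ) (μ ν : Measure (Rn n)) [SFinite μ] [SFinite ν] :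
    Measurable (heatEnergy n μ ν) := by
  have : heatEnergy n μ ν = fun t => ∫⁻ p : Rn n × Rn n, heat n t p.1 p.2 ∂(μ.prod ν) :=
    funext (heatEnergy_eq n μ ν)
  rw [this]
  exact (measurable_heat n).lintegral_prod_right'

lemma mutualEnergy_heatMix (n : ℕ) (m : Measure ℝ) [SFinite m] (μ ν : Measure (Rn n))
    [SFinite μ] [SFinite ν] :
    mutualEnergy (heatMix n m) μ ν = ∫⁻ t, heatEnergy n μ ν t ∂m := by
  simp_rw [heatEnergy_eq]
  unfold mutualEnergy heatMix
  rw [lintegral_lintegral_swap]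
  exact ((measurable_heat n).comp measurable_swap).aemeasurable

lemma heatEnergy_add (n : ℕ) {s t : ℝ} (hs : 0 < s) (ht : 0 < t) (μ ν : Measure (Rn n))
    [SFinite μ] [SFinite ν] :
    heatEnergy n μ ν (s + t) = ∫⁻ y, potential (heat n s) μ y * potential (heat n t) ν y := by
  unfold heatEnergy
  rw [← Measure.dirac_conv_dirac, mutualEnergy_conv n _ _ (ae_pos_dirac hs) (ae_pos_dirac ht)]
  simp only [potential, heatMix_dirac]

lemma two_mul_le_add_sq_ennreal (a b : ℝ≥0∞) : 2 * (a * b) ≤ a ^ 2 + b ^ 2 := by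
  rcases eq_or_ne a ⊤ with rfl | ha
  · simp
  rcases eq_or_ne b ⊤ with rfl | hb
  · simp
  lift a to NNReal using ha
  lift b to NNReal using hb
  norm_cast
  rw [← mul_assoc]
  exact two_mul_le_add_sq a b

/-- Schur's test for a symmetric sub-Markov kernel. -/
lemma lintegral_mul_kernel_le {X : Type*} [MeasurableSpace X] {vol : Measure X} [SFinite vol]
    {q : X → X → ℝ≥0∞} (hq : Measurable (Function.uncurry q)) (hsymm : ∀ x y, q x y = q y x)
    (hmass : ∀ x, ∫⁻ y, q x y ∂vol ≤ 1) {f : X → ℝ≥0∞} (hf : Measurable f) :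
    ∫⁻ x, f x * ∫⁻ y, q x y * f y ∂vol ∂vol ≤ ∫⁻ x, f x ^ 2 ∂vol := by
  have hqx : ∀ x, Measurable (q x) := fun x => hq.of_uncurry_left
  have e1 : ∫⁻ x, ∫⁻ y, q x y * f x ^ 2 ∂vol ∂vol ≤ ∫⁻ x, f x ^ 2 ∂vol := by
    refine lintegral_mono fun x => ?_
    rw [lintegral_mul_const _ (hqx x)]
    exact mul_le_of_le_one_left' (hmass x)
  have hm1 : Measurable fun p : X × X => q p.1 p.2 * f p.1 ^ 2 :=
    hq.mul ((hf.comp measurable_fst).pow_const 2)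
  have e2 : ∫⁻ x, ∫⁻ y, q x y * f y ^ 2 ∂vol ∂vol = ∫⁻ x, ∫⁻ y, q x y * f x ^ 2 ∂vol ∂vol := by
    rw [lintegral_lintegral_swap
      (hq.mul ((hf.comp measurable_snd).pow_const 2)).aemeasurable]
    simp_rw [fun x y => hsymm x y]
  have e3 : 2 * ∫⁻ x, f x * ∫⁻ y, q x y * f y ∂vol ∂vol
      ≤ ∫⁻ x, ∫⁻ y, q x y * f x ^ 2 ∂vol ∂vol + ∫⁻ x, ∫⁻ y, q x y * f y ^ 2 ∂vol ∂vol := by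
    rw [← lintegral_const_mul' _ _ (by simp), ← lintegral_add_left hm1.lintegral_prod_right']
    refine lintegral_mono fun x => ?_
    have hm2 : Measurable fun y => q x y * f y := (hqx x).mul hf
    dsimp only
    rw [← lintegral_const_mul _ hm2, ← lintegral_const_mul _ (hm2.const_mul _),
      ← lintegral_add_left ((hqx x).mul_const _)]
    refine lintegral_mono fun y => ?_
    calc 2 * (f x * (q x y * f y)) = q x y * (2 * (f x * f y)) := by ring
      _ ≤ q x y * (f x ^ 2 + f y ^ 2) := by gcongr; exact two_mul_le_add_sq_ennreal _ _
      _ = _ := by ring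
  rw [e2, ← two_mul] at e3
  exact ((ENNReal.mul_le_mul_iff_right (by simp) (by simp)).1 e3).trans e1

lemma heatEnergy_add_le (n : ℕ) {r t : ℝ} (hr : 0 < r) (ht : 0 < t) (μ : Measure (Rn n))
    [SFinite μ] : heatEnergy n μ μ (r + t) ≤ heatEnergy n μ μ t := by
  have ht2 : 0 < t / 2 := by positivity
  have h1 := heatEnergy_add n ht2 ht2 μ μ
  rw [add_halves] at h1
  have h2 := heatEnergy_add n ht2 (add_pos hr ht2) μ μ
  have h3 : t / 2 + (r + t / 2) = r + t := by ring
  rw [h3] at h2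
  have h4 : ∀ y, potential (heat n (r + t / 2)) μ y
      = ∫⁻ z, heat n r y z * potential (heat n (t / 2)) μ z := by
    intro y
    have := potential_conv n (Measure.dirac r) (Measure.dirac (t / 2)) (ae_pos_dirac hr)
      (ae_pos_dirac ht2) μ y
    rw [Measure.dirac_conv_dirac] at this
    simpa only [potential, heatMix_dirac] using this
  have hmeas : Measurable (potential (heat n (t / 2)) μ) := by
    have := measurable_potential_heatMix n (Measure.dirac (t / 2)) μ
    unfold potential at this ⊢
    simpa only [heatMix_dirac] using this
  rw [h1, h2]
  simp_rw [h4, ← pow_two]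
  refine lintegral_mul_kernel_le ?_ (heat_symm n r) (fun x => (lintegral_heat n hr x).le) hmeas
  exact (measurable_heat n).comp (measurable_const.prodMk measurable_id)

lemma energy_conv_le (n : ℕ) (m m' : Measure ℝ) [SFinite m] [SFinite m']
    (hm : ∀ᵐ t ∂m, 0 < t) (hm' : ∀ᵐ t ∂m', 0 < t) (μ : Measure (Rn n)) [SFinite μ] :
    energy (heatMix n (m ∗ m')) μ ≤ m univ * energy (heatMix n m') μ := by
  unfold energy
  rw [mutualEnergy_heatMix, mutualEnergy_heatMix,
    Measure.lintegral_conv (measurable_heatEnergy n μ μ), mul_comm, ← lintegral_const]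
  refine lintegral_mono_ae ?_
  filter_upwards [hm] with r hr
  refine lintegral_mono_ae ?_
  filter_upwards [hm'] with t ht
  exact heatEnergy_add_le n hr ht μ

/-- The truncated positive part `min(1, N (u₂ - u₁)⁺)`. -/
def truncDiff (N u₁ u₂ : ℝ≥0∞) : ℝ≥0∞ := min 1 (N * (u₂ - u₁))

lemma truncDiff_le_one (N u₁ u₂ : ℝ≥0∞) : truncDiff N u₁ u₂ ≤ 1 := min_le_left _ _

lemma truncDiff_mul_le (N u₁ u₂ : ℝ≥0∞) : truncDiff N u₁ u₂ * u₁ ≤ truncDiff N u₁ u₂ * u₂ := by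
  rcases le_total u₁ u₂ with h | h
  · gcongr
  · simp [truncDiff, tsub_eq_zero_of_le h]

lemma truncDiff_mono_of_add_le (N : ℝ≥0∞) {a₁ a₂ b₁ b₂ : ℝ≥0∞} (ha : a₁ ≠ ⊤)
    (h : b₂ + a₁ ≤ a₂ + b₁) : truncDiff N b₁ b₂ ≤ truncDiff N a₁ a₂ := by
  refine min_le_min le_rfl (mul_le_mul_right (tsub_le_iff_right.2 ?_) N)
  refine (ENNReal.add_le_add_iff_right ha).1 (h.trans ?_)
  calc a₂ + b₁ ≤ (a₂ - a₁ + a₁) + b₁ := by gcongr; exact le_tsub_add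
    _ = a₂ - a₁ + b₁ + a₁ := by ring

lemma truncDiff_rearrange (N : ℝ≥0∞) {a₁ a₂ b₁ b₂ : ℝ≥0∞} (ha₁ : a₁ ≠ ⊤) (ha₂ : a₂ ≠ ⊤)
    (hb₁ : b₁ ≠ ⊤) (hb₂ : b₂ ≠ ⊤) :
    truncDiff N a₁ a₂ * a₁ + truncDiff N b₁ b₂ * b₁
        + (truncDiff N a₁ a₂ * b₂ + truncDiff N b₁ b₂ * a₂)
      ≤ truncDiff N a₁ a₂ * a₂ + truncDiff N b₁ b₂ * b₂
        + (truncDiff N a₁ a₂ * b₁ + truncDiff N b₁ b₂ * a₁) := by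
  have hS : truncDiff N a₁ a₂ ≠ ⊤ := ne_top_of_le_ne_top one_ne_top (truncDiff_le_one _ _ _)
  have hT : truncDiff N b₁ b₂ ≠ ⊤ := ne_top_of_le_ne_top one_ne_top (truncDiff_le_one _ _ _)
  have h1 : b₂ + a₁ ≤ a₂ + b₁ → truncDiff N b₁ b₂ ≤ truncDiff N a₁ a₂ :=
    truncDiff_mono_of_add_le N ha₁
  have h2 : a₂ + b₁ ≤ b₂ + a₁ → truncDiff N a₁ a₂ ≤ truncDiff N b₁ b₂ :=
    truncDiff_mono_of_add_le N hb₁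
  generalize truncDiff N a₁ a₂ = S at *
  generalize truncDiff N b₁ b₂ = T at *
  lift a₁ to NNReal using ha₁
  lift a₂ to NNReal using ha₂
  lift b₁ to NNReal using hb₁
  lift b₂ to NNReal using hb₂
  lift S to NNReal using hS
  lift T to NNReal using hT
  norm_cast at *
  rcases le_total (b₂ + a₁) (a₂ + b₁) with h | h
  · have h' := h1 h
    rw [← NNReal.coe_le_coe] at *
    push_cast at *
    nlinarith [mul_nonneg (sub_nonneg.2 h) (sub_nonneg.2 h')]
  · have h' := h2 h
    rw [← NNReal.coe_le_coe] at *
    push_cast at *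
    nlinarith [mul_nonneg (sub_nonneg.2 h) (sub_nonneg.2 h')]

lemma Measurable.truncDiff {X : Type*} [MeasurableSpace X] (N : ℝ≥0∞) {u₁ u₂ : X → ℝ≥0∞}
    (h₁ : Measurable u₁) (h₂ : Measurable u₂) :
    Measurable fun x => GaussVar.truncDiff N (u₁ x) (u₂ x) :=
  measurable_const.min ((h₂.sub h₁).const_mul N)

/-- The Markovian contraction property of `1 - q`, for a symmetric sub-Markov kernel `q`. -/
lemma lintegral_truncDiff_kernel {X : Type*} [MeasurableSpace X] {vol : Measure X} [SFinite vol]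
    {q : X → X → ℝ≥0∞} (hq : Measurable (Function.uncurry q)) (hsymm : ∀ x y, q x y = q y x)
    (hmass : ∀ x, ∫⁻ y, q x y ∂vol ≤ 1) {u₁ u₂ : X → ℝ≥0∞} (h₁ : Measurable u₁)
    (h₂ : Measurable u₂) (ht₁ : ∀ᵐ x ∂vol, u₁ x < ⊤) (ht₂ : ∀ᵐ x ∂vol, u₂ x < ⊤) (N : ℝ≥0∞) :
    ∫⁻ x, truncDiff N (u₁ x) (u₂ x) * u₁ x ∂vol
        + ∫⁻ x, truncDiff N (u₁ x) (u₂ x) * ∫⁻ y, q x y * u₂ y ∂vol ∂vol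
      ≤ ∫⁻ x, truncDiff N (u₁ x) (u₂ x) * u₂ x ∂vol
        + ∫⁻ x, truncDiff N (u₁ x) (u₂ x) * ∫⁻ y, q x y * u₁ y ∂vol ∂vol := by
  have hT := Measurable.truncDiff N h₁ h₂
  have hTl := fun x => truncDiff_mul_le N (u₁ x) (u₂ x)
  have hpt := fun x y (hx1 : u₁ x < ⊤) (hx2 : u₂ x < ⊤) (hy1 : u₁ y < ⊤) (hy2 : u₂ y < ⊤) =>
    truncDiff_rearrange N hx1.ne hx2.ne hy1.ne hy2.ne
  generalize hTd : (fun x => truncDiff N (u₁ x) (u₂ x)) = T at hT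
  have hTd' : ∀ x, truncDiff N (u₁ x) (u₂ x) = T x := fun x => congrFun hTd x
  simp only [hTd'] at hpt hTl ⊢
  have hqx : ∀ x, Measurable (q x) := fun x => hq.of_uncurry_left
  have hmm : Measurable fun x => ∫⁻ y, q x y ∂vol := hq.lintegral_prod_right'
  have prod_meas : ∀ {f g : X → ℝ≥0∞}, Measurable f → Measurable g →
      Measurable fun p : X × X => q p.1 p.2 * (f p.1 * g p.2) := fun hf hg =>
    hq.mul ((hf.comp measurable_fst).mul (hg.comp measurable_snd))
  -- the diagonal terms
  have ediag : ∀ u : X → ℝ≥0∞, Measurable u →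
      ∫⁻ p, q p.1 p.2 * (T p.1 * u p.1 + T p.2 * u p.2) ∂(vol.prod vol)
        = 2 * ∫⁻ x, (∫⁻ y, q x y ∂vol) * (T x * u x) ∂vol := by
    intro u hu
    have m1 := prod_meas (hT.mul hu) (measurable_const (a := (1 : ℝ≥0∞)))
    have m2 := prod_meas (measurable_const (a := (1 : ℝ≥0∞))) (hT.mul hu)
    simp only [mul_one, one_mul, Pi.mul_apply] at m1 m2
    simp_rw [mul_add]
    rw [lintegral_add_left m1, two_mul]
    have e1 : ∫⁻ p : X × X, q p.1 p.2 * (T p.1 * u p.1) ∂(vol.prod vol)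
        = ∫⁻ x, (∫⁻ y, q x y ∂vol) * (T x * u x) ∂vol := by
      rw [lintegral_prod _ m1.aemeasurable]
      refine lintegral_congr fun x => ?_
      dsimp only
      exact lintegral_mul_const _ (hqx x)
    have e2 : ∫⁻ p : X × X, q p.1 p.2 * (T p.2 * u p.2) ∂(vol.prod vol)
        = ∫⁻ p : X × X, q p.1 p.2 * (T p.1 * u p.1) ∂(vol.prod vol) := by
      rw [← lintegral_prod_swap]
      exact lintegral_congr fun p => by simp [hsymm p.2 p.1]
    rw [e2, e1]
  have ecross : ∀ u : X → ℝ≥0∞, Measurable u →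
      ∫⁻ p, q p.1 p.2 * (T p.1 * u p.2 + T p.2 * u p.1) ∂(vol.prod vol)
        = 2 * ∫⁻ x, T x * ∫⁻ y, q x y * u y ∂vol ∂vol := by
    intro u hu
    have m1 := prod_meas hT hu
    simp_rw [mul_add]
    rw [lintegral_add_left m1, two_mul]
    have e1 : ∫⁻ p : X × X, q p.1 p.2 * (T p.1 * u p.2) ∂(vol.prod vol)
        = ∫⁻ x, T x * ∫⁻ y, q x y * u y ∂vol ∂vol := by
      rw [lintegral_prod _ m1.aemeasurable]
      refine lintegral_congr fun x => ?_
      have : Measurable fun y => q x y * u y := (hqx x).mul hu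
      rw [← lintegral_const_mul _ this]
      exact lintegral_congr fun y => mul_left_comm _ _ _
    have e2 : ∫⁻ p : X × X, q p.1 p.2 * (T p.2 * u p.1) ∂(vol.prod vol)
        = ∫⁻ p : X × X, q p.1 p.2 * (T p.1 * u p.2) ∂(vol.prod vol) := by
      rw [← lintegral_prod_swap]
      exact lintegral_congr fun p => by simp [hsymm p.2 p.1]
    rw [e2, e1]
  have mdiag : ∀ u : X → ℝ≥0∞, Measurable u →
      Measurable fun p : X × X => q p.1 p.2 * (T p.1 * u p.1 + T p.2 * u p.2) := fun u hu =>
    hq.mul (((hT.mul hu).comp measurable_fst).add ((hT.mul hu).comp measurable_snd))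
  have hfin : ∀ᵐ p ∂(vol.prod vol), (u₁ p.1 < ⊤ ∧ u₂ p.1 < ⊤) ∧ (u₁ p.2 < ⊤ ∧ u₂ p.2 < ⊤) := by
    have ha : ∀ᵐ x ∂vol, u₁ x < ⊤ ∧ u₂ x < ⊤ := ht₁.and ht₂
    exact (Measure.quasiMeasurePreserving_fst.ae ha).and
      (Measure.quasiMeasurePreserving_snd.ae ha)
  have main : 2 * ∫⁻ x, (∫⁻ y, q x y ∂vol) * (T x * u₁ x) ∂vol
        + 2 * ∫⁻ x, T x * ∫⁻ y, q x y * u₂ y ∂vol ∂vol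
      ≤ 2 * ∫⁻ x, (∫⁻ y, q x y ∂vol) * (T x * u₂ x) ∂vol
        + 2 * ∫⁻ x, T x * ∫⁻ y, q x y * u₁ y ∂vol ∂vol := by
    rw [← ediag u₁ h₁, ← ediag u₂ h₂, ← ecross u₁ h₁, ← ecross u₂ h₂,
      ← lintegral_add_left (mdiag u₁ h₁), ← lintegral_add_left (mdiag u₂ h₂)]
    refine lintegral_mono_ae ?_
    filter_upwards [hfin] with p hp
    rw [← mul_add, ← mul_add]
    gcongr q p.1 p.2 * ?_
    exact hpt p.1 p.2 hp.1.1 hp.1.2 hp.2.1 hp.2.2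
  rw [← mul_add, ← mul_add, ENNReal.mul_le_mul_iff_right (by simp) (by simp)] at main
  have split : ∀ u : X → ℝ≥0∞, Measurable u → ∫⁻ x, T x * u x ∂vol
      = ∫⁻ x, (∫⁻ y, q x y ∂vol) * (T x * u x) ∂vol
        + ∫⁻ x, (1 - ∫⁻ y, q x y ∂vol) * (T x * u x) ∂vol := by
    intro u hu
    have : Measurable fun x => (∫⁻ y, q x y ∂vol) * (T x * u x) := hmm.mul (hT.mul hu)
    rw [← lintegral_add_left this]
    refine lintegral_congr fun x => ?_
    rw [← add_mul, add_tsub_cancel_of_le (hmass x), one_mul]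
  rw [split u₁ h₁, split u₂ h₂]
  have hr : ∫⁻ x, (1 - ∫⁻ y, q x y ∂vol) * (T x * u₁ x) ∂vol
      ≤ ∫⁻ x, (1 - ∫⁻ y, q x y ∂vol) * (T x * u₂ x) ∂vol :=
    lintegral_mono fun x => mul_le_mul_right (hTl x) _
  rw [add_right_comm, add_right_comm (∫⁻ x, (∫⁻ y, q x y ∂vol) * (T x * u₂ x) ∂vol)]
  exact add_le_add main hr

/-- If `uᵢ` solves `uᵢ = Bᵢ + q uᵢ` with `q` symmetric sub-Markov and `uᵢ` square integrable,
then `∫ T B₁ ≤ ∫ T B₂` for the truncation `T` of `(u₂ - u₁)⁺`. -/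
lemma lintegral_truncDiff_mul_le {X : Type*} [MeasurableSpace X] {vol : Measure X} [SFinite vol]
    {q : X → X → ℝ≥0∞} (hq : Measurable (Function.uncurry q)) (hsymm : ∀ x y, q x y = q y x)
    (hmass : ∀ x, ∫⁻ y, q x y ∂vol ≤ 1) {u₁ u₂ B₁ B₂ : X → ℝ≥0∞} (h₁ : Measurable u₁)
    (h₂ : Measurable u₂) (hB₁ : Measurable B₁) (hB₂ : Measurable B₂)
    (he₁ : ∀ x, u₁ x = B₁ x + ∫⁻ y, q x y * u₁ y ∂vol)
    (he₂ : ∀ x, u₂ x = B₂ x + ∫⁻ y, q x y * u₂ y ∂vol)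
    (hi₁ : ∫⁻ x, u₁ x ^ 2 ∂vol < ⊤) (hi₂ : ∫⁻ x, u₂ x ^ 2 ∂vol < ⊤)
    {N : ℝ≥0∞} (hN : N ≠ ⊤) :
    ∫⁻ x, truncDiff N (u₁ x) (u₂ x) * B₁ x ∂vol
      ≤ ∫⁻ x, truncDiff N (u₁ x) (u₂ x) * B₂ x ∂vol := by
  have fin : ∀ {u : X → ℝ≥0∞}, Measurable u → ∫⁻ x, u x ^ 2 ∂vol < ⊤ → ∀ᵐ x ∂vol, u x < ⊤ := by
    intro u hu hi
    filter_upwards [ae_lt_top (hu.pow_const 2) hi.ne] with x hx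
    by_contra h
    rw [not_lt, top_le_iff] at h
    simp [h] at hx
  have key := lintegral_truncDiff_kernel hq hsymm hmass h₁ h₂ (fin h₁ hi₁) (fin h₂ hi₂) N
  have hT := Measurable.truncDiff N h₁ h₂
  have a2 : ∫⁻ x, truncDiff N (u₁ x) (u₂ x) * u₂ x ∂vol < ⊤ := by
    calc ∫⁻ x, truncDiff N (u₁ x) (u₂ x) * u₂ x ∂vol ≤ ∫⁻ x, N * u₂ x ^ 2 ∂vol := by
          refine lintegral_mono fun x => ?_
          rw [pow_two, ← mul_assoc]
          gcongr
          exact (min_le_right _ _).trans (by gcongr; exact tsub_le_self)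
      _ = N * ∫⁻ x, u₂ x ^ 2 ∂vol := lintegral_const_mul _ (h₂.pow_const 2)
      _ < ⊤ := ENNReal.mul_lt_top hN.lt_top hi₂
  have a1 : ∫⁻ x, truncDiff N (u₁ x) (u₂ x) * u₁ x ∂vol < ⊤ :=
    (lintegral_mono fun x => truncDiff_mul_le N (u₁ x) (u₂ x)).trans_lt a2
  have e : ∀ {u B : X → ℝ≥0∞}, Measurable B → (∀ x, u x = B x + ∫⁻ y, q x y * u y ∂vol) →
      ∫⁻ x, truncDiff N (u₁ x) (u₂ x) * u x ∂vol
        = ∫⁻ x, truncDiff N (u₁ x) (u₂ x) * B x ∂vol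
          + ∫⁻ x, truncDiff N (u₁ x) (u₂ x) * ∫⁻ y, q x y * u y ∂vol ∂vol := by
    intro u B hB he
    have : Measurable fun x => truncDiff N (u₁ x) (u₂ x) * B x := hT.mul hB
    rw [← lintegral_add_left this]
    refine lintegral_congr fun x => ?_
    rw [← mul_add, ← he]
  have e1 := e hB₁ he₁
  have e2 := e hB₂ he₂
  rw [e1] at key a1
  rw [e2] at key a2
  have b1 := (ENNReal.add_lt_top.1 a1).2
  have b2 := (ENNReal.add_lt_top.1 a2).2
  rw [add_right_comm, add_assoc, add_assoc,
    add_comm (∫⁻ x, truncDiff N (u₁ x) (u₂ x) * ∫⁻ y, q x y * u₂ y ∂vol ∂vol)] at key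
  refine (ENNReal.add_le_add_iff_right (ENNReal.add_lt_top.2 ⟨b1, b2⟩).ne).1 ?_
  convert key using 1

/-- The measure with density `c t ^ (a - 1) exp (-p t)` on `(0, ∞)`. -/
def gam (c a p : ℝ) : Measure ℝ :=
  (volume.restrict (Ioi 0)).withDensity
    fun t => ENNReal.ofReal (c * t ^ (a - 1) * Real.exp (-(p * t)))

instance (c a p : ℝ) : SFinite (gam c a p) := by unfold gam; infer_instance

lemma measurable_gam_density (c a p : ℝ) :
    Measurable fun t : ℝ => ENNReal.ofReal (c * t ^ (a - 1) * Real.exp (-(p * t))) := by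
  fun_prop

lemma ae_pos_gam (c a p : ℝ) : ∀ᵐ t ∂(gam c a p), 0 < t := by
  have h : ∀ᵐ t ∂((volume : Measure ℝ).restrict (Ioi 0)), 0 < t := ae_restrict_mem measurableSet_Ioi
  exact (withDensity_absolutelyContinuous _ _).ae_le h

lemma lintegral_gam (c a p : ℝ) {g : ℝ → ℝ≥0∞} (hg : Measurable g) :
    ∫⁻ t, g t ∂(gam c a p)
      = ∫⁻ t in Ioi 0, ENNReal.ofReal (c * t ^ (a - 1) * Real.exp (-(p * t))) * g t :=
  lintegral_withDensity_eq_lintegral_mul _ (measurable_gam_density c a p) hg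

lemma lintegral_ofReal_of_integral_pos {Y : Type*} [MeasurableSpace Y] {m : Measure Y} {g : Y → ℝ}
    {v : ℝ} (hg : 0 ≤ᵐ[m] g) (hv : 0 < v) (h : ∫ x, g x ∂m = v) :
    ∫⁻ x, ENNReal.ofReal (g x) ∂m = ENNReal.ofReal v := by
  rw [← h, ofReal_integral_eq_lintegral_ofReal _ hg]
  by_contra hi
  rw [integral_undef hi] at h
  exact hv.ne h

lemma gam_univ {c a p : ℝ} (hc : 0 < c) (ha : 0 < a) (hp : 0 < p) :
    gam c a p univ = ENNReal.ofReal (c * ((1 / p) ^ a * Real.Gamma a)) := by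
  have hG := Real.Gamma_pos_of_pos ha
  rw [← lintegral_one, lintegral_gam c a p measurable_const]
  simp only [mul_one]
  refine lintegral_ofReal_of_integral_pos ?_ (by positivity) ?_
  · filter_upwards [ae_restrict_mem measurableSet_Ioi] with t ht
    have : 0 < t := ht
    simp only [Pi.zero_apply]
    positivity
  · simp_rw [mul_assoc]
    rw [integral_const_mul, ← Real.integral_rpow_mul_exp_neg_mul_Ioi ha hp]

lemma gam_univ_lt_top {c a p : ℝ} (hc : 0 < c) (ha : 0 < a) (hp : 0 < p) :
    gam c a p univ < ⊤ := by
  rw [gam_univ hc ha hp]; exact ENNReal.ofReal_lt_top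

lemma lintegral_rpow_exp_neg_div {δ B : ℝ} (hδ : 0 < δ) (hB : 0 < B) :
    ∫⁻ t in Ioi (0 : ℝ), ENNReal.ofReal (t ^ (-δ - 1) * Real.exp (-(B / t)))
      = ENNReal.ofReal ((1 / B) ^ δ * Real.Gamma δ) := by
  have hG := Real.Gamma_pos_of_pos hδ
  refine lintegral_ofReal_of_integral_pos ?_ (by positivity) ?_
  · filter_upwards [ae_restrict_mem measurableSet_Ioi] with t ht
    have : 0 < t := ht
    simp only [Pi.zero_apply]
    positivity
  · rw [← Real.integral_rpow_mul_exp_neg_mul_Ioi hδ hB,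
      ← integral_comp_rpow_Ioi (fun v => v ^ (δ - 1) * Real.exp (-(B * v))) (p := -1)
        (by norm_num)]
    refine setIntegral_congr_fun measurableSet_Ioi fun t ht => ?_
    have ht : 0 < t := ht
    simp only [smul_eq_mul]
    rw [← Real.rpow_mul ht.le, ← mul_assoc, mul_assoc |(-1 : ℝ)|, ← Real.rpow_add ht,
      Real.rpow_neg_one]
    norm_num
    rw [div_eq_mul_inv]
    ring_nf

/-- The Riesz kernel is a mixture of heat kernels. -/
lemma exists_rieszKernel_eq_heatMix (n : ℕ) (α : ℝ) (hαn : α < n) :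
    ∃ C : ℝ, 0 < C ∧ rieszKernel n α = heatMix n (gam C (α / 2) 0) := by
  set δ : ℝ := ((n : ℝ) - α) / 2 with hδd
  have hδ : 0 < δ := by simp only [hδd]; linarith
  have hG := Real.Gamma_pos_of_pos hδ
  set w : ℝ := (4 * Real.pi) ^ (-(n : ℝ) / 2) with hw
  have hw0 : 0 < w := by positivity
  set C : ℝ := (w * Real.Gamma δ * 4 ^ δ)⁻¹ with hC
  have hC0 : 0 < C := by positivity
  refine ⟨C, hC0, ?_⟩
  have hf : ∀ x y : Rn n, heatMix n (gam C (α / 2) 0) x y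
      = ENNReal.ofReal (C * w) *
        ∫⁻ t in Ioi (0 : ℝ), ENNReal.ofReal (t ^ (-δ - 1) * Real.exp (-(‖x - y‖ ^ 2 / 4 / t))) := by
    intro x y
    unfold heatMix
    rw [lintegral_gam _ _ _ (measurable_heat_time n x y), ← lintegral_const_mul _ (by fun_prop)]
    refine setLIntegral_congr_fun measurableSet_Ioi fun t ht => ?_
    have ht : 0 < t := ht
    rw [heat, ← ENNReal.ofReal_mul (by positivity), ← ENNReal.ofReal_mul (by positivity),
      Real.mul_rpow (by positivity) ht.le]
    congr 1
    have e1 : t ^ (-δ - 1) = t ^ (α / 2 - 1) * t ^ (-(n : ℝ) / 2) := by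
      rw [← Real.rpow_add ht]; congr 1; simp only [hδd]; ring
    have e2 : -(‖x - y‖ ^ 2 / 4 / t) = -(1 / (4 * t)) * ‖x - y‖ ^ 2 := by field_simp
    rw [e1, e2]
    simp only [zero_mul, neg_zero, Real.exp_zero]
    ring
  funext x y
  rw [hf, rieszKernel]
  rcases eq_or_ne x y with rfl | hxy
  · have hneg : α - (n : ℝ) < 0 := by linarith
    simp only [dist_self, ENNReal.ofReal_zero, ENNReal.zero_rpow_of_neg hneg, sub_self, norm_zero]
    have : ∫⁻ t in Ioi (0 : ℝ), ENNReal.ofReal (t ^ (-δ - 1) * Real.exp (-((0 : ℝ) ^ 2 / 4 / t)))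
        = ⊤ := by
      by_contra h
      refine not_integrableOn_Ioi_rpow (-δ - 1) ?_
      have hcg : ∫⁻ t in Ioi (0 : ℝ), ENNReal.ofReal (t ^ (-δ - 1)) ≠ ⊤ := by
        simpa using h
      rw [IntegrableOn, ← lintegral_ofReal_ne_top_iff_integrable (by fun_prop) ?_]
      · exact hcg
      · filter_upwards [ae_restrict_mem measurableSet_Ioi] with t ht
        have : 0 < t := ht
        simp only [Pi.zero_apply]
        positivity
    rw [this, ENNReal.mul_top]
    simpa using mul_pos hC0 hw0
  · have hd : 0 < ‖x - y‖ := norm_pos_iff.2 (sub_ne_zero.2 hxy)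
    rw [dist_eq_norm, ENNReal.ofReal_rpow_of_pos hd,
      lintegral_rpow_exp_neg_div hδ (by positivity), ← ENNReal.ofReal_mul (by positivity)]
    congr 1
    have e1 : (1 / (‖x - y‖ ^ 2 / 4)) ^ δ = 4 ^ δ * ‖x - y‖ ^ (α - n) := by
      rw [one_div_div, Real.div_rpow (by norm_num) (by positivity), ← Real.rpow_natCast,
        ← Real.rpow_mul hd.le, div_eq_mul_inv, ← Real.rpow_neg hd.le]
      congr 2
      simp only [hδd]; push_cast; ring
    rw [e1, hC]
    field_simp

lemma gam_eq_withDensity_indicator (c a p : ℝ) :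
    gam c a p = volume.withDensity ((Ioi 0).indicator
      fun t => ENNReal.ofReal (c * t ^ (a - 1) * Real.exp (-(p * t)))) :=
  (withDensity_indicator measurableSet_Ioi _).symm

lemma lintegral_Ioo_rpow {a x : ℝ} (ha : 0 < a) (hx : 0 < x) :
    ∫⁻ y in Ioo 0 x, ENNReal.ofReal (y ^ (a - 1)) = ENNReal.ofReal (x ^ a / a) := by
  refine lintegral_ofReal_of_integral_pos ?_ (by positivity) ?_
  · filter_upwards [ae_restrict_mem measurableSet_Ioo] with t ht
    have : 0 < t := ht.1
    simp only [Pi.zero_apply]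
    positivity
  · rw [← integral_Ioc_eq_integral_Ioo, ← intervalIntegral.integral_of_le hx.le,
      integral_rpow (Or.inl (by linarith))]
    simp [Real.zero_rpow ha.ne']

lemma gam_conv {c c' a p : ℝ} (hc : 0 < c) (hc' : 0 < c') (ha : 0 < a) :
    gam c 1 p ∗ gam c' a p = gam (c * c' / a) (a + 1) p := by
  rw [Measure.conv_comm]
  simp_rw [gam_eq_withDensity_indicator]
  rw [conv_withDensity_eq_lconvolution ((measurable_gam_density c' a p).indicator measurableSet_Ioi)
    ((measurable_gam_density c 1 p).indicator measurableSet_Ioi)]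
  congr 1
  funext x
  rw [lconvolution_def]
  have key : ∀ y, (Ioi (0 : ℝ)).indicator
        (fun t => ENNReal.ofReal (c' * t ^ (a - 1) * Real.exp (-(p * t)))) y *
      (Ioi (0 : ℝ)).indicator
        (fun t => ENNReal.ofReal (c * t ^ ((1 : ℝ) - 1) * Real.exp (-(p * t)))) (-y + x)
      = (Ioo 0 x).indicator (fun y => ENNReal.ofReal (c * c' * Real.exp (-(p * x))) *
          ENNReal.ofReal (y ^ (a - 1))) y := by
    intro y
    by_cases hy : 0 < y
    · by_cases hyx : y < x
      · have h1 : 0 < -y + x := by linarith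
        rw [indicator_of_mem (by exact hy), indicator_of_mem (by exact h1),
          indicator_of_mem (by exact ⟨hy, hyx⟩), ← ENNReal.ofReal_mul (by positivity),
          ← ENNReal.ofReal_mul (by positivity)]
        congr 1
        have : Real.exp (-(p * x)) = Real.exp (-(p * y)) * Real.exp (-(p * (-y + x))) := by
          rw [← Real.exp_add]; congr 1; ring
        rw [this]
        simp only [sub_self, Real.rpow_zero]
        ring
      · rw [indicator_of_notMem (s := Ioo 0 x) (fun h => hyx h.2),
          indicator_of_notMem (a := -y + x) (fun h => hyx (by have : 0 < -y + x := h; linarith)),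
          mul_zero]
    · rw [indicator_of_notMem (s := Ioo 0 x) (fun h => hy h.1),
        indicator_of_notMem (s := Ioi 0) (a := y) (fun h => hy h), zero_mul]
  simp_rw [key]
  rw [lintegral_indicator measurableSet_Ioo, lintegral_const_mul _ (by fun_prop)]
  by_cases hx : 0 < x
  · rw [lintegral_Ioo_rpow ha hx, indicator_of_mem (by exact hx),
      ← ENNReal.ofReal_mul (by positivity)]
    congr 1
    rw [add_sub_cancel_right]
    ring
  · rw [indicator_of_notMem (s := Ioi 0) (a := x) (fun h => hx h), Ioo_eq_empty (fun h => hx h)]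
    simp

/-- Taylor coefficients of `(1 - z) ^ (-s)`. -/
def negBinom (s : ℝ) : ℕ → ℝ
  | 0 => 1
  | k + 1 => negBinom s k * ((k + s) / (k + 1))

/-- The partial products `∏ i ∈ [1, k], (1 - s / i)`. -/
def tailProd (s : ℝ) : ℕ → ℝ
  | 0 => 1
  | k + 1 => tailProd s k * (1 - s / (k + 1))

/-- The coefficient of `z ^ (k + 1)` in `1 - (1 - z) ^ s`. -/
def subBinom (s : ℝ) (k : ℕ) : ℝ := tailProd s k * (s / (k + 1))

lemma negBinom_pos {s : ℝ} (hs : 0 < s) (k : ℕ) : 0 < negBinom s k := by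
  induction k with
  | zero => simp [negBinom]
  | succ k ih => unfold negBinom; positivity

lemma tailProd_nonneg {s : ℝ} (hs1 : s ≤ 1) (k : ℕ) : 0 ≤ tailProd s k := by
  induction k with
  | zero => simp [tailProd]
  | succ k ih =>
    refine mul_nonneg ih (sub_nonneg.2 ?_)
    rw [div_le_one (by positivity)]
    have : (0 : ℝ) ≤ k := by positivity
    linarith

lemma subBinom_nonneg {s : ℝ} (hs : 0 < s) (hs1 : s ≤ 1) (k : ℕ) : 0 ≤ subBinom s k :=
  mul_nonneg (tailProd_nonneg hs1 k) (by positivity)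

lemma sum_range_subBinom (s : ℝ) (m : ℕ) :
    ∑ k ∈ Finset.range m, subBinom s k = 1 - tailProd s m := by
  induction m with
  | zero => simp [tailProd]
  | succ m ih => rw [Finset.sum_range_succ, ih, tailProd, subBinom]; ring

lemma tsum_subBinom_le {s : ℝ} (hs : 0 < s) (hs1 : s ≤ 1) :
    ∑' k, ENNReal.ofReal (subBinom s k) ≤ 1 := by
  rw [ENNReal.tsum_eq_iSup_nat]
  refine iSup_le fun m => ?_
  rw [← ENNReal.ofReal_sum_of_nonneg fun k _ => subBinom_nonneg hs hs1 k, sum_range_subBinom]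
  exact ENNReal.ofReal_le_one.2 (by linarith [tailProd_nonneg hs1 m])

lemma negBinom_succ_eq (s : ℝ) (k : ℕ) :
    negBinom s (k + 1)
      = ∑ p ∈ Finset.HasAntidiagonal.antidiagonal k, subBinom s p.1 * negBinom s p.2 := by
  set e : ℕ → ℝ := fun i => Nat.casesOn i 1 fun j => -subBinom s j with he
  have he0 : e 0 = 1 := rfl
  have hes : ∀ j, e (j + 1) = -subBinom s j := fun j => rfl
  have hrec : ∀ i : ℕ, ((i : ℝ) + 1) * e (i + 1) = (i - s) * e i := by
    intro i
    cases i with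
    | zero => simp [he0, hes, subBinom, tailProd]
    | succ j =>
      rw [hes, hes, subBinom, subBinom, tailProd]
      push_cast
      field_simp
  have harec : ∀ i : ℕ, ((i : ℝ) + 1) * negBinom s (i + 1) = (i + s) * negBinom s i := by
    intro i
    rw [negBinom]
    field_simp
  set S : ℕ → ℝ := fun m => ∑ p ∈ Finset.HasAntidiagonal.antidiagonal m,
    e p.1 * negBinom s p.2 with hS
  have hSrec : ∀ m : ℕ, ((m : ℝ) + 1) * S (m + 1) = m * S m := by
    intro m
    have h1 : ((m : ℝ) + 1) * S (m + 1)
        = ∑ p ∈ Finset.HasAntidiagonal.antidiagonal (m + 1), (p.1 : ℝ) * e p.1 * negBinom s p.2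
          + ∑ p ∈ Finset.HasAntidiagonal.antidiagonal (m + 1), e p.1 * ((p.2 : ℝ) * negBinom s p.2) := by
      rw [hS, Finset.mul_sum, ← Finset.sum_add_distrib]
      refine Finset.sum_congr rfl fun p hp => ?_
      have : ((p.1 : ℝ) + p.2) = m + 1 := by exact_mod_cast Finset.HasAntidiagonal.mem_antidiagonal.1 hp
      rw [← this]; ring
    rw [h1, Finset.Nat.sum_antidiagonal_succ, Finset.Nat.sum_antidiagonal_succ']
    push_cast
    simp_rw [hrec, harec]
    rw [hS, Finset.mul_sum]
    simp only [zero_mul, mul_zero, zero_add]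
    rw [← Finset.sum_add_distrib]
    refine Finset.sum_congr rfl fun p hp => ?_
    have : ((p.1 : ℝ) + p.2) = m := by exact_mod_cast Finset.HasAntidiagonal.mem_antidiagonal.1 hp
    rw [← this]; ring
  have hS0 : ∀ m, S (m + 1) = 0 := by
    intro m
    induction m with
    | zero => simpa using hSrec 0
    | succ m ih =>
      have := hSrec (m + 1)
      rw [ih, mul_zero] at this
      exact (mul_eq_zero.1 this).resolve_left (by push_cast; positivity)
  have := hS0 k
  rw [hS] at this
  simp only at this
  rw [Finset.Nat.sum_antidiagonal_succ] at this
  simp only [he0, hes, one_mul, neg_mul, Finset.sum_neg_distrib] at this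
  linarith

lemma tsum_tsum_eq_tsum_antidiagonal (F : ℕ → ℕ → ℝ≥0∞) :
    ∑' j, ∑' k, F j k = ∑' m, ∑ p ∈ Finset.HasAntidiagonal.antidiagonal m, F p.1 p.2 := by
  rw [← ENNReal.tsum_prod, ← Finset.HasAntidiagonal.sigmaAntidiagonalEquivProd.tsum_eq, ENNReal.tsum_sigma']
  refine tsum_congr fun m => ?_
  rw [← Finset.tsum_subtype]
  rfl

/-- Normalising constants: `gamCoef b s C k * t ^ (s + k - 1)` arises from `C * t ^ (s - 1)` by `k`
convolutions with `b`. -/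
def gamCoef (b s C : ℝ) : ℕ → ℝ
  | 0 => C
  | k + 1 => b * gamCoef b s C k / (s + k)

lemma gamCoef_pos {b s C : ℝ} (hb : 0 < b) (hs : 0 < s) (hC : 0 < C) (k : ℕ) :
    0 < gamCoef b s C k := by
  induction k with
  | zero => exact hC
  | succ k ih => unfold gamCoef; positivity

/-- The `k`-fold convolution of `gam C s p` with `gam b 1 p`. -/
def gamIter (b p s C : ℝ) (k : ℕ) : Measure ℝ := gam (gamCoef b s C k) (s + k) p

instance (b p s C : ℝ) (k : ℕ) : SFinite (gamIter b p s C k) := by unfold gamIter; infer_instance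

lemma gamIter_zero (b p s C : ℝ) : gamIter b p s C 0 = gam C s p := by
  simp [gamIter, gamCoef]

lemma ae_pos_gamIter (b p s C : ℝ) (k : ℕ) : ∀ᵐ t ∂(gamIter b p s C k), 0 < t := ae_pos_gam _ _ _

lemma conv_gamIter {b p s C : ℝ} (hb : 0 < b) (hs : 0 < s) (hC : 0 < C) (k : ℕ) :
    gam b 1 p ∗ gamIter b p s C k = gamIter b p s C (k + 1) := by
  unfold gamIter
  rw [gam_conv hb (gamCoef_pos hb hs hC k) (by positivity), gamCoef]
  congr 1
  push_cast
  ring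

lemma gamIter_conv_gamIter {b p s C : ℝ} (hb : 0 < b) (hs : 0 < s) (hC : 0 < C) (j k : ℕ) :
    gamIter b p 1 b j ∗ gamIter b p s C k = gamIter b p s C (j + k + 1) := by
  induction j with
  | zero => rw [gamIter_zero, conv_gamIter hb hs hC, zero_add]
  | succ j ih =>
    rw [← conv_gamIter hb one_pos hb, Measure.conv_assoc, ih, conv_gamIter hb hs hC]
    congr 1
    ring

lemma conv_univ (m m' : Measure ℝ) [SFinite m] [SFinite m'] :
    (m ∗ m') univ = m univ * m' univ := by
  rw [← lintegral_one, Measure.lintegral_conv measurable_const]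
  simp [mul_comm]

lemma gamIter_univ_le_one {b p : ℝ} (hb : 0 < b) (hp : b ≤ p) (j : ℕ) :
    gamIter b p 1 b j univ ≤ 1 := by
  have h1 : gam b 1 p univ ≤ 1 := by
    rw [gam_univ hb one_pos (hb.trans_le hp)]
    refine ENNReal.ofReal_le_one.2 ?_
    simp only [one_div, Real.rpow_one, Real.Gamma_one, mul_one]
    rw [← div_eq_mul_inv]
    exact div_le_one_of_le₀ hp (hb.le.trans hp)
  induction j with
  | zero => rwa [gamIter_zero]
  | succ j ih =>
    rw [← conv_gamIter hb one_pos hb, conv_univ]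
    exact mul_le_one' h1 ih

lemma negBinom_mul_gamCoef {b s C : ℝ} (hs : 0 < s) (k : ℕ) :
    negBinom s k * gamCoef b s C k = C * (b ^ k / k.factorial) := by
  induction k with
  | zero => simp [negBinom, gamCoef]
  | succ k ih =>
    have h : negBinom s (k + 1) * gamCoef b s C (k + 1)
        = (negBinom s k * gamCoef b s C k) * (b / (k + 1)) := by
      rw [negBinom, gamCoef]
      have : s + k ≠ 0 := by positivity
      have : (k : ℝ) + s ≠ 0 := by positivity
      field_simp
      ring
    rw [h, ih, Nat.factorial_succ]
    push_cast
    field_simp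
    ring

/-- Exponential series: `gam C s l` is a mixture of the iterates of `gam C s (b + l)`. -/
lemma lintegral_gam_eq_tsum {b s C : ℝ} (l : ℝ) (hb : 0 < b) (hs : 0 < s) (hC : 0 < C)
    {g : ℝ → ℝ≥0∞} (hg : Measurable g) :
    ∫⁻ t, g t ∂(gam C s l)
      = ∑' k, ENNReal.ofReal (negBinom s k) * ∫⁻ t, g t ∂(gamIter b (b + l) s C k) := by
  unfold gamIter
  simp_rw [lintegral_gam _ _ _ hg]
  have hm : ∀ k : ℕ, Measurable fun t : ℝ => ENNReal.ofReal (gamCoef b s C k * t ^ (s + k - 1) *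
      Real.exp (-((b + l) * t))) * g t := fun k => (measurable_gam_density _ _ _).mul hg
  simp_rw [← lintegral_const_mul _ (hm _)]
  rw [← lintegral_tsum fun k => ((hm k).const_mul _).aemeasurable]
  refine setLIntegral_congr_fun measurableSet_Ioi fun t ht => ?_
  have ht : 0 < t := ht
  simp_rw [← mul_assoc]
  rw [ENNReal.tsum_mul_right]
  congr 1
  have e : ∀ k : ℕ, ENNReal.ofReal (negBinom s k) *
      ENNReal.ofReal (gamCoef b s C k * t ^ (s + k - 1) * Real.exp (-((b + l) * t)))
      = ENNReal.ofReal (C * t ^ (s - 1) * Real.exp (-((b + l) * t)) *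
          ((b * t) ^ k / k.factorial)) := by
    intro k
    rw [← ENNReal.ofReal_mul (negBinom_pos hs k).le]
    congr 1
    have e1 : t ^ (s + k - 1) = t ^ (s - 1) * t ^ k := by
      rw [← Real.rpow_natCast, ← Real.rpow_add ht]; congr 1; ring
    rw [e1, ← mul_assoc, ← mul_assoc, negBinom_mul_gamCoef hs]
    ring
  simp_rw [e]
  have hsum : HasSum (fun k : ℕ => C * t ^ (s - 1) * Real.exp (-((b + l) * t)) *
      ((b * t) ^ k / k.factorial)) (C * t ^ (s - 1) * Real.exp (-((b + l) * t)) *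
        Real.exp (b * t)) := by
    refine HasSum.mul_left _ ?_
    rw [Real.exp_eq_exp_ℝ]
    exact NormedSpace.expSeries_div_hasSum_exp (b * t)
  rw [← ENNReal.ofReal_tsum_of_nonneg (fun k => by positivity) hsum.summable, hsum.tsum_eq]
  congr 1
  rw [mul_assoc _ (Real.exp _) (Real.exp _), ← Real.exp_add]
  ring_nf

lemma potential_gam_eq_tsum (n : ℕ) {b s C : ℝ} (l : ℝ) (hb : 0 < b) (hs : 0 < s) (hC : 0 < C)
    (μ : Measure (Rn n)) [SFinite μ] (x : Rn n) :
    potential (heatMix n (gam C s l)) μ x = ∑' k, ENNReal.ofReal (negBinom s k) *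
      potential (heatMix n (gamIter b (b + l) s C k)) μ x := by
  unfold potential
  have hm : ∀ k : ℕ, Measurable fun y => heatMix n (gamIter b (b + l) s C k) x y := fun k =>
    measurable_heatMix_right n _ x
  simp_rw [← lintegral_const_mul _ (hm _)]
  rw [← lintegral_tsum fun k => ((hm k).const_mul _).aemeasurable]
  exact lintegral_congr fun y => lintegral_gam_eq_tsum l hb hs hC (measurable_heat_time n x y)

/-- The potentials of `gam C s l` are potentials `u = B + q u` with respect to a symmetric
sub-Markov kernel `q`. -/
lemma exists_subMarkov (n : ℕ) {b l s C : ℝ} (hb : 0 < b) (hl : 0 ≤ l) (hs : 0 < s) (hs1 : s ≤ 1)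
    (hC : 0 < C) : ∃ q : Rn n → Rn n → ℝ≥0∞, Measurable (Function.uncurry q) ∧
      (∀ x y, q x y = q y x) ∧ (∀ x, ∫⁻ y, q x y ≤ 1) ∧
      ∀ (μ : Measure (Rn n)) [SFinite μ] (x : Rn n), potential (heatMix n (gam C s l)) μ x
        = potential (heatMix n (gam C s (b + l))) μ x
          + ∫⁻ y, q x y * potential (heatMix n (gam C s l)) μ y := by
  have hmr := fun j x => measurable_heatMix_right n (gamIter b (b + l) 1 b j) x
  refine ⟨fun x y => ∑' j, ENNReal.ofReal (subBinom s j) *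
    heatMix n (gamIter b (b + l) 1 b j) x y, ?_, ?_, ?_, ?_⟩
  · exact Measurable.tsum fun j => (measurable_heatMix n _).const_mul _
  · intro x y
    simp_rw [heatMix_symm n _ x y]
  · intro x
    rw [lintegral_tsum fun j => ((hmr j x).const_mul _).aemeasurable]
    refine le_trans (ENNReal.tsum_le_tsum fun j => ?_) (tsum_subBinom_le hs hs1)
    rw [lintegral_const_mul _ (hmr j x), lintegral_heatMix n _ (ae_pos_gamIter _ _ _ _ _)]
    exact mul_le_of_le_one_right' (gamIter_univ_le_one hb (by linarith) j)
  · intro μ _ x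
    set v : ℕ → Rn n → ℝ≥0∞ := fun k => potential (heatMix n (gamIter b (b + l) s C k)) μ with hv
    have hvm : ∀ k, Measurable (v k) := fun k => measurable_potential_heatMix n _ μ
    have hu : ∀ y, potential (heatMix n (gam C s l)) μ y
        = ∑' k, ENNReal.ofReal (negBinom s k) * v k y := fun y =>
      potential_gam_eq_tsum n l hb hs hC μ y
    have hvv : ∀ j k, ∫⁻ y, heatMix n (gamIter b (b + l) 1 b j) x y * v k y = v (j + k + 1) x := by
      intro j k
      rw [hv]
      simp only
      rw [← potential_conv n _ _ (ae_pos_gamIter _ _ _ _ _) (ae_pos_gamIter _ _ _ _ _),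
        gamIter_conv_gamIter hb hs hC]
    have hQ : ∫⁻ y, (∑' j, ENNReal.ofReal (subBinom s j) *
          heatMix n (gamIter b (b + l) 1 b j) x y) * potential (heatMix n (gam C s l)) μ y
        = ∑' m, ENNReal.ofReal (negBinom s (m + 1)) * v (m + 1) x := by
      have e1 : ∀ y, (∑' j, ENNReal.ofReal (subBinom s j) *
          heatMix n (gamIter b (b + l) 1 b j) x y) * potential (heatMix n (gam C s l)) μ y
          = ∑' j, ∑' k, ENNReal.ofReal (subBinom s j) * ENNReal.ofReal (negBinom s k) *
            (heatMix n (gamIter b (b + l) 1 b j) x y * v k y) := by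
        intro y
        rw [hu, ← ENNReal.tsum_mul_right]
        refine tsum_congr fun j => ?_
        rw [← ENNReal.tsum_mul_left]
        exact tsum_congr fun k => by ring
      have hm : ∀ j k, Measurable fun y => ENNReal.ofReal (subBinom s j) *
          ENNReal.ofReal (negBinom s k) * (heatMix n (gamIter b (b + l) 1 b j) x y * v k y) :=
        fun j k => ((hmr j x).mul (hvm k)).const_mul _
      simp_rw [e1]
      rw [lintegral_tsum fun j => (Measurable.tsum fun k => hm j k).aemeasurable]
      simp_rw [lintegral_tsum fun k => (hm _ k).aemeasurable]
      have e2 : ∀ j k, ∫⁻ y, ENNReal.ofReal (subBinom s j) * ENNReal.ofReal (negBinom s k) *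
          (heatMix n (gamIter b (b + l) 1 b j) x y * v k y)
          = ENNReal.ofReal (subBinom s j) * ENNReal.ofReal (negBinom s k) * v (j + k + 1) x := by
        intro j k
        have : Measurable fun y => heatMix n (gamIter b (b + l) 1 b j) x y * v k y :=
          (hmr j x).mul (hvm k)
        rw [lintegral_const_mul _ this, hvv]
      simp_rw [e2]
      rw [tsum_tsum_eq_tsum_antidiagonal]
      refine tsum_congr fun m => ?_
      rw [negBinom_succ_eq, ENNReal.ofReal_sum_of_nonneg fun p _ =>
        mul_nonneg (subBinom_nonneg hs hs1 _) (negBinom_pos hs _).le, Finset.sum_mul]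
      refine Finset.sum_congr rfl fun p hp => ?_
      rw [Finset.HasAntidiagonal.mem_antidiagonal.1 hp,
        ENNReal.ofReal_mul (subBinom_nonneg hs hs1 _)]
    rw [hQ, hu x, tsum_eq_zero_add' ENNReal.summable]
    congr 1
    simp [negBinom, hv, gamIter_zero]

lemma measurable_potential_heat_time (n : ℕ) (μ : Measure (Rn n)) [SFinite μ] (x : Rn n) :
    Measurable fun t => potential (heat n t) μ x := by
  unfold potential
  exact Measurable.lintegral_prod_right' (f := fun q : ℝ × Rn n => heat n q.1 x q.2)
    (measurable_heat_right n x)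

lemma potential_heatMix (n : ℕ) (m : Measure ℝ) [SFinite m] (μ : Measure (Rn n)) [SFinite μ]
    (x : Rn n) : potential (heatMix n m) μ x = ∫⁻ t, potential (heat n t) μ x ∂m := by
  unfold potential heatMix
  rw [lintegral_lintegral_swap]
  exact ((measurable_heat_right n x).comp measurable_swap).aemeasurable

lemma lintegral_gam_anti {C s p p' : ℝ} (hC : 0 ≤ C) (h : p ≤ p') {g : ℝ → ℝ≥0∞}
    (hg : Measurable g) : ∫⁻ t, g t ∂(gam C s p') ≤ ∫⁻ t, g t ∂(gam C s p) := by
  rw [lintegral_gam _ _ _ hg, lintegral_gam _ _ _ hg]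
  refine setLIntegral_mono' measurableSet_Ioi fun t ht => ?_
  have ht : 0 < t := ht
  gcongr

lemma tendsto_lintegral_gam {C : ℝ} (s p : ℝ) (hC : 0 < C) {g : ℝ → ℝ≥0∞} (hg : Measurable g) :
    Tendsto (fun k : ℕ => ∫⁻ t, g t ∂(gam C s (p + 1 / ((k : ℝ) + 1)))) atTop
      (𝓝 (∫⁻ t, g t ∂(gam C s p))) := by
  simp_rw [lintegral_gam _ _ _ hg]
  refine lintegral_tendsto_of_tendsto_of_monotone
    (fun k => ((measurable_gam_density _ _ _).mul hg).aemeasurable) ?_ ?_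
  · filter_upwards [ae_restrict_mem measurableSet_Ioi] with t ht
    intro k l hkl
    have ht : 0 < t := ht
    have : (1 : ℝ) / ((l : ℝ) + 1) ≤ 1 / ((k : ℝ) + 1) :=
      one_div_le_one_div_of_le (by positivity) (by gcongr)
    dsimp only
    gcongr
  · filter_upwards [ae_restrict_mem measurableSet_Ioi] with t ht
    have ht : 0 < t := ht
    refine ENNReal.Tendsto.mul_const (ENNReal.tendsto_ofReal ?_) (Or.inl ?_)
    · have h1 : Tendsto (fun k : ℕ => p + 1 / ((k : ℝ) + 1)) atTop (𝓝 (p + 0)) :=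
        tendsto_const_nhds.add tendsto_one_div_add_atTop_nhds_zero_nat
      rw [add_zero] at h1
      exact tendsto_const_nhds.mul
        ((Real.continuous_exp.tendsto _).comp (h1.mul_const t).neg)
    · rw [Ne, ENNReal.ofReal_eq_zero, not_le]
      positivity

lemma lintegral_potential_heatMix (n : ℕ) (m : Measure ℝ) [SFinite m] (hm : ∀ᵐ t ∂m, 0 < t)
    (ν : Measure (Rn n)) [SFinite ν] : ∫⁻ y, potential (heatMix n m) ν y = m univ * ν univ := by
  have h := lintegral_lintegral_heatMix_mul n m ν (f := fun _ => 1) measurable_const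
  simp only [mul_one, one_mul, lintegral_heatMix n m hm, lintegral_const] at h
  exact h.symm

lemma energy_gam_anti (n : ℕ) {C s p p' : ℝ} (hC : 0 ≤ C) (h : p ≤ p') (μ : Measure (Rn n))
    [SFinite μ] : energy (heatMix n (gam C s p')) μ ≤ energy (heatMix n (gam C s p)) μ := by
  unfold energy
  rw [mutualEnergy_heatMix, mutualEnergy_heatMix]
  exact lintegral_gam_anti hC h (measurable_heatEnergy n μ μ)

lemma lintegral_potential_sq_lt_top (n : ℕ) {C s p : ℝ} (hC : 0 < C) (hs : 0 < s) (hp : 0 < p)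
    (μ : Measure (Rn n)) [SFinite μ] (hμ : energy (heatMix n (gam C s 0)) μ < ⊤) :
    ∫⁻ x, potential (heatMix n (gam C s p)) μ x ^ 2 < ⊤ := by
  simp_rw [pow_two]
  rw [← mutualEnergy_conv n _ _ (ae_pos_gam _ _ _) (ae_pos_gam _ _ _)]
  refine (energy_conv_le n _ _ (ae_pos_gam _ _ _) (ae_pos_gam _ _ _) μ).trans_lt ?_
  exact ENNReal.mul_lt_top (gam_univ_lt_top hC hs hp)
    ((energy_gam_anti n hC.le hp.le μ).trans_lt hμ)

lemma lintegral_truncDiff_potential_le_of_pos (n : ℕ) {C s b l : ℝ} (hC : 0 < C) (hs : 0 < s)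
    (hs1 : s ≤ 1) (hb : 0 < b) (hl : 0 < l) (μ ν : Measure (Rn n)) [SFinite μ] [SFinite ν]
    (hμ : energy (heatMix n (gam C s 0)) μ < ⊤) (hν : energy (heatMix n (gam C s 0)) ν < ⊤)
    {N : ℝ≥0∞} (hN : N ≠ ⊤) :
    ∫⁻ x, truncDiff N (potential (heatMix n (gam C s l)) μ x)
        (potential (heatMix n (gam C s l)) ν x) * potential (heatMix n (gam C s (b + l))) μ x
      ≤ gam C s b univ * ν univ := by
  obtain ⟨q, hq, hsymm, hmass, he⟩ := exists_subMarkov n hb hl.le hs hs1 hC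
  refine (lintegral_truncDiff_mul_le hq hsymm hmass (measurable_potential_heatMix n _ μ)
    (measurable_potential_heatMix n _ ν) (measurable_potential_heatMix n _ μ)
    (measurable_potential_heatMix n _ ν) (he μ) (he ν)
    (lintegral_potential_sq_lt_top n hC hs hl μ hμ)
    (lintegral_potential_sq_lt_top n hC hs hl ν hν) hN).trans ?_
  rw [← lintegral_potential_heatMix n (gam C s b) (ae_pos_gam _ _ _) ν]
  refine lintegral_mono fun x => ?_
  refine (mul_le_of_le_one_left' (truncDiff_le_one _ _ _)).trans ?_
  rw [potential_heatMix, potential_heatMix]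
  exact lintegral_gam_anti hC.le (by linarith) (measurable_potential_heat_time n ν x)

lemma tendsto_potential_gam (n : ℕ) {C : ℝ} (s p : ℝ) (hC : 0 < C) (μ : Measure (Rn n))
    [SFinite μ] (x : Rn n) :
    Tendsto (fun k : ℕ => potential (heatMix n (gam C s (p + 1 / ((k : ℝ) + 1)))) μ x) atTop
      (𝓝 (potential (heatMix n (gam C s p)) μ x)) := by
  simp_rw [potential_heatMix]
  exact tendsto_lintegral_gam s p hC (measurable_potential_heat_time n μ x)

lemma truncDiff_mul_le_liminf {N u v w : ℝ≥0∞} (hN : N ≠ ⊤) {u' v' w' : ℕ → ℝ≥0∞}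
    (hu : Tendsto u' atTop (𝓝 u)) (hv : Tendsto v' atTop (𝓝 v)) (hw : Tendsto w' atTop (𝓝 w)) :
    truncDiff N u v * w ≤ liminf (fun k => truncDiff N (u' k) (v' k) * w' k) atTop := by
  rcases eq_or_ne (truncDiff N u v) 0 with h0 | h0
  · simp [h0]
  have hfin : u ≠ ⊤ := by
    rintro rfl
    exact h0 (by simp [truncDiff])
  have hTS : Tendsto (fun k => truncDiff N (u' k) (v' k)) atTop (𝓝 (truncDiff N u v)) :=
    tendsto_const_nhds.min (ENNReal.Tendsto.const_mul (ENNReal.Tendsto.sub hv hu (Or.inr hfin))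
      (Or.inr hN))
  have hS1 : truncDiff N u v ≠ ⊤ := ne_top_of_le_ne_top one_ne_top (truncDiff_le_one _ _ _)
  exact (ENNReal.Tendsto.mul hTS (Or.inl h0) hw (Or.inr hS1)).liminf_eq.ge

/-- Passing to the limit `l → 0` in the contraction inequality. -/
lemma lintegral_truncDiff_potential_le (n : ℕ) {C s b : ℝ} (hC : 0 < C) (hs : 0 < s) (hs1 : s ≤ 1)
    (hb : 0 < b) (μ ν : Measure (Rn n)) [SFinite μ] [SFinite ν]
    (hμ : energy (heatMix n (gam C s 0)) μ < ⊤) (hν : energy (heatMix n (gam C s 0)) ν < ⊤)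
    {N : ℝ≥0∞} (hN : N ≠ ⊤) :
    ∫⁻ x, truncDiff N (potential (heatMix n (gam C s 0)) μ x)
        (potential (heatMix n (gam C s 0)) ν x) * potential (heatMix n (gam C s b)) μ x
      ≤ gam C s b univ * ν univ := by
  have hmeas : ∀ k : ℕ, Measurable fun x =>
      truncDiff N (potential (heatMix n (gam C s (0 + 1 / ((k : ℝ) + 1)))) μ x)
        (potential (heatMix n (gam C s (0 + 1 / ((k : ℝ) + 1)))) ν x) *
        potential (heatMix n (gam C s (b + 1 / ((k : ℝ) + 1)))) μ x := fun k =>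
    (Measurable.truncDiff N (measurable_potential_heatMix n _ μ)
      (measurable_potential_heatMix n _ ν)).mul (measurable_potential_heatMix n _ μ)
  refine le_trans (lintegral_mono fun x => truncDiff_mul_le_liminf hN
    (tendsto_potential_gam n s 0 hC μ x) (tendsto_potential_gam n s 0 hC ν x)
    (tendsto_potential_gam n s b hC μ x)) ((lintegral_liminf_le hmeas).trans
    ((liminf_le_liminf (Eventually.of_forall fun k => ?_)).trans (liminf_const _).le))
  rw [zero_add]
  exact lintegral_truncDiff_potential_le_of_pos n hC hs hs1 hb (by positivity) μ ν hμ hν hN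

lemma lintegral_comp_smul_pos {V : Type*} [NormedAddCommGroup V] [NormedSpace ℝ V]
    [MeasurableSpace V] [BorelSpace V] [FiniteDimensional ℝ V] (m : Measure V) [m.IsAddHaarMeasure]
    {r : ℝ} (hr : 0 < r) {F : V → ℝ≥0∞} (hF : Measurable F) :
    ∫⁻ z, F (r • z) ∂m = ENNReal.ofReal ((r ^ Module.finrank ℝ V)⁻¹) * ∫⁻ z, F z ∂m := by
  rw [← lintegral_map hF (measurable_const_smul r), Measure.map_addHaar_smul m hr.ne',
    lintegral_smul_measure, abs_of_pos (by positivity), smul_eq_mul]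

lemma lintegral_gam_scale (C s : ℝ) {b : ℝ} (hb : 0 < b) {g : ℝ → ℝ≥0∞}
    (hg : Measurable g) : ∫⁻ t, g t ∂(gam C s b)
      = ENNReal.ofReal (b ^ (-s)) * ∫⁻ t, g (b⁻¹ * t) ∂(gam C s 1) := by
  have hgb : Measurable fun t => g (b⁻¹ * t) := hg.comp (measurable_const_mul _)
  rw [lintegral_gam _ _ _ hg, lintegral_gam _ _ _ hgb, ← lintegral_indicator measurableSet_Ioi,
    ← lintegral_indicator measurableSet_Ioi]
  have hm : Measurable ((Ioi (0 : ℝ)).indicator fun t =>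
      ENNReal.ofReal (C * t ^ (s - 1) * Real.exp (-(1 * t))) * g (b⁻¹ * t)) :=
    ((measurable_gam_density _ _ _).mul hgb).indicator measurableSet_Ioi
  have h := lintegral_comp_smul_pos volume hb hm
  rw [Module.finrank_self, pow_one] at h
  have hcancel : ENNReal.ofReal (b ^ (-s)) = ENNReal.ofReal (b ^ (1 - s)) * ENNReal.ofReal b⁻¹ := by
    rw [← ENNReal.ofReal_mul (by positivity), ← Real.rpow_neg_one b, ← Real.rpow_add hb]
    congr 2
    ring
  have hm' : Measurable fun t : ℝ => (Ioi (0 : ℝ)).indicator (fun t =>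
      ENNReal.ofReal (C * t ^ (s - 1) * Real.exp (-(1 * t))) * g (b⁻¹ * t)) (b • t) :=
    hm.comp (measurable_const_smul b)
  rw [hcancel, mul_assoc, ← h, ← lintegral_const_mul _ hm']
  refine lintegral_congr fun t => ?_
  by_cases ht : 0 < t
  · have hbt : 0 < b * t := by positivity
    rw [indicator_of_mem (by exact ht), smul_eq_mul, indicator_of_mem (by exact hbt), ← mul_assoc,
      ← ENNReal.ofReal_mul (by positivity), inv_mul_cancel_left₀ hb.ne']
    congr 2
    rw [Real.mul_rpow hb.le ht.le, one_mul]
    have : b ^ (1 - s) * b ^ (s - 1) = 1 := by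
      rw [← Real.rpow_add hb]; simp
    linear_combination (-C * t ^ (s - 1) * Real.exp (-(b * t))) * this
  · rw [indicator_of_notMem (by exact ht), smul_eq_mul, indicator_of_notMem, mul_zero]
    exact fun h => ht ((mul_pos_iff_of_pos_left hb).1 h)

lemma lintegral_heat_mul_eq (n : ℕ) {t : ℝ} (ht : 0 < t) (x : Rn n) {G : Rn n → ℝ≥0∞}
    (hG : Measurable G) : ∫⁻ y, heat n t x y * G y
      = ∫⁻ z, heat n 1 0 z * G (x + Real.sqrt t • z) := by
  have hr : 0 < Real.sqrt t := Real.sqrt_pos.2 ht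
  have hpow : t ^ (-(n : ℝ) / 2) = (Real.sqrt t ^ n)⁻¹ := by
    rw [Real.sqrt_eq_rpow, ← Real.rpow_natCast, ← Real.rpow_mul ht.le, ← Real.rpow_neg ht.le]
    congr 1
    ring
  have hh : Measurable fun w : Rn n => heat n 1 0 ((Real.sqrt t)⁻¹ • w) :=
    ((measurable_heat_right n 0).comp (measurable_const.prodMk measurable_id)).comp
      (measurable_const_smul _)
  have hF : Measurable fun w : Rn n => heat n 1 0 ((Real.sqrt t)⁻¹ • w) * G (x + w) :=
    hh.mul (hG.comp (measurable_const_add x))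
  have h := lintegral_comp_smul_pos volume hr hF
  simp only [inv_smul_smul₀ hr.ne'] at h
  rw [h, ← lintegral_const_mul _ hF, ← lintegral_add_left_eq_self _ x]
  refine lintegral_congr fun w => ?_
  rw [← mul_assoc]
  congr 1
  rw [heat, heat, ← ENNReal.ofReal_mul (by positivity)]
  congr 1
  rw [finrank_euclideanSpace_fin, zero_sub, norm_neg, norm_smul, norm_inv, Real.norm_eq_abs,
    abs_of_pos hr, mul_pow, inv_pow, Real.sq_sqrt ht.le, sub_add_cancel_left, norm_neg,
    Real.mul_rpow (by positivity) ht.le, hpow]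
  simp only [mul_one]
  field_simp

lemma measurable_potential_heat (n : ℕ) (μ : Measure (Rn n)) [SFinite μ] :
    Measurable fun p : ℝ × Rn n => potential (heat n p.1) μ p.2 := by
  unfold potential
  exact Measurable.lintegral_prod_right' (f := fun q : (ℝ × Rn n) × Rn n => heat n q.1.1 q.1.2 q.2)
    ((measurable_heat n).comp ((measurable_fst.comp measurable_fst).prodMk
      ((measurable_snd.comp measurable_fst).prodMk measurable_snd)))

lemma lintegral_mul_potential_heatMix (n : ℕ) (m : Measure ℝ) [SFinite m] (μ : Measure (Rn n))
    [SFinite μ] {G : Rn n → ℝ≥0∞} (hG : Measurable G) :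
    ∫⁻ y, G y * potential (heatMix n m) μ y
      = ∫⁻ t, (∫⁻ y, G y * potential (heat n t) μ y) ∂m := by
  have h : Measurable fun p : Rn n × ℝ => G p.1 * potential (heat n p.2) μ p.1 :=
    (hG.comp measurable_fst).mul ((measurable_potential_heat n μ).comp measurable_swap)
  rw [← lintegral_lintegral_swap h.aemeasurable]
  refine lintegral_congr fun y => ?_
  rw [lintegral_const_mul _ (measurable_potential_heat_time n μ y), potential_heatMix]

lemma measurable_lintegral_mul_potential_heat (n : ℕ) (μ : Measure (Rn n))
    [SFinite μ] {G : Rn n → ℝ≥0∞} (hG : Measurable G) :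
    Measurable fun t => ∫⁻ y, G y * potential (heat n t) μ y :=
  Measurable.lintegral_prod_right' (f := fun p : ℝ × Rn n => G p.2 * potential (heat n p.1) μ p.2)
    ((hG.comp measurable_snd).mul (measurable_potential_heat n μ))

lemma lintegral_mul_potential_heat (n : ℕ) (t : ℝ) (μ : Measure (Rn n))
    [SFinite μ] {G : Rn n → ℝ≥0∞} (hG : Measurable G) :
    ∫⁻ y, G y * potential (heat n t) μ y = ∫⁻ x, (∫⁻ y, heat n t x y * G y) ∂μ := by
  have h := lintegral_lintegral_heatMix_mul n (Measure.dirac t) μ hG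
  simp only [potential, heatMix_dirac] at h ⊢
  exact h.symm

lemma tendsto_heat (n : ℕ) (t : ℝ) {ι : Type*} {l : Filter ι} {y : ι → Rn n} {x : Rn n}
    (hy : Tendsto y l (𝓝 x)) (z : Rn n) :
    Tendsto (fun i => heat n t (y i) z) l (𝓝 (heat n t x z)) := by
  unfold heat
  refine ENNReal.tendsto_ofReal (Tendsto.const_mul _ ?_)
  exact (Real.continuous_exp.tendsto _).comp (((hy.sub_const z).norm.pow 2).const_mul _)

lemma potential_heatMix_le_liminf (n : ℕ) (m : Measure ℝ) [SFinite m] (μ : Measure (Rn n))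
    [SFinite μ] {ι : Type*} {l : Filter ι} [l.NeBot] [l.IsCountablyGenerated] {y : ι → Rn n}
    {x : Rn n} (hy : Tendsto y l (𝓝 x)) :
    potential (heatMix n m) μ x ≤ liminf (fun i => potential (heatMix n m) μ (y i)) l := by
  unfold potential
  calc ∫⁻ z, heatMix n m x z ∂μ ≤ ∫⁻ z, liminf (fun i => heatMix n m (y i) z) l ∂μ := by
        refine lintegral_mono fun z => ?_
        unfold heatMix
        calc ∫⁻ t, heat n t x z ∂m = ∫⁻ t, liminf (fun i => heat n t (y i) z) l ∂m :=
              lintegral_congr fun t => (tendsto_heat n t hy z).liminf_eq.symm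
          _ ≤ _ := lintegral_liminf_le fun i => measurable_heat_time n (y i) z
    _ ≤ _ := lintegral_liminf_le fun i => measurable_heatMix_right n m (y i)

lemma le_liminf_lintegral_heat (n : ℕ) {G : Rn n → ℝ≥0∞} (hG : Measurable G) (x : Rn n)
    (hlsc : ∀ y : ℝ → Rn n, Tendsto y (𝓝[>] 0) (𝓝 x) → G x ≤ liminf (fun t => G (y t)) (𝓝[>] 0)) :
    G x ≤ liminf (fun t => ∫⁻ y, heat n t x y * G y) (𝓝[>] 0) := by
  have hm1 : Measurable (heat n 1 0) :=
    (measurable_heat_right n 0).comp (measurable_const.prodMk measurable_id)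
  calc G x = ∫⁻ z, heat n 1 0 z * G x := by
        rw [lintegral_mul_const _ hm1, lintegral_heat n one_pos, one_mul]
    _ ≤ ∫⁻ z, liminf (fun t => heat n 1 0 z * G (x + Real.sqrt t • z)) (𝓝[>] 0) := by
        refine lintegral_mono fun z => ?_
        rw [ENNReal.liminf_const_mul_of_ne_top (heat_lt_top n 1 0 z).ne]
        gcongr
        refine hlsc _ ?_
        have h : Continuous fun t : ℝ => x + Real.sqrt t • z := by fun_prop
        have := h.tendsto 0
        simp only [Real.sqrt_zero, zero_smul, add_zero] at this
        exact this.mono_left nhdsWithin_le_nhds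
    _ ≤ liminf (fun t => ∫⁻ z, heat n 1 0 z * G (x + Real.sqrt t • z)) (𝓝[>] 0) := by
        refine lintegral_liminf_le fun t => hm1.mul (hG.comp ?_)
        exact (measurable_const_smul (Real.sqrt t)).const_add x
    _ = _ := by
        refine liminf_congr ?_
        filter_upwards [self_mem_nhdsWithin] with t ht
        exact (lintegral_heat_mul_eq n ht x hG).symm

lemma le_liminf_lintegral_mul_potential_heat (n : ℕ) (μ : Measure (Rn n)) [SFinite μ]
    {G : Rn n → ℝ≥0∞} (hG : Measurable G)
    (hlsc : ∀ x, ∀ y : ℝ → Rn n, Tendsto y (𝓝[>] 0) (𝓝 x) →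
      G x ≤ liminf (fun t => G (y t)) (𝓝[>] 0)) :
    ∫⁻ x, G x ∂μ ≤ liminf (fun t => ∫⁻ y, G y * potential (heat n t) μ y) (𝓝[>] 0) := by
  simp_rw [lintegral_mul_potential_heat n _ μ hG]
  refine (lintegral_mono fun x => le_liminf_lintegral_heat n hG x (hlsc x)).trans ?_
  refine lintegral_liminf_le fun t => ?_
  refine Measurable.lintegral_prod_right' (f := fun p : Rn n × Rn n => heat n t p.1 p.2 * G p.2) ?_
  exact ((measurable_heat n).comp (measurable_const.prodMk measurable_id)).mul
    (hG.comp measurable_snd)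

lemma lintegral_le_of_lintegral_gam_le (n : ℕ) {C s : ℝ} (hC : 0 < C) (hs : 0 < s)
    (μ : Measure (Rn n)) [SFinite μ] {G : Rn n → ℝ≥0∞} (hG : Measurable G)
    (hlsc : ∀ x, ∀ y : ℝ → Rn n, Tendsto y (𝓝[>] 0) (𝓝 x) →
      G x ≤ liminf (fun t => G (y t)) (𝓝[>] 0)) {K : ℝ≥0∞}
    (hK : ∀ b : ℝ, 0 < b → ∫⁻ y, G y * potential (heatMix n (gam C s b)) μ y
      ≤ gam C s b univ * K) : ∫⁻ x, G x ∂μ ≤ K := by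
  have hD := measurable_lintegral_mul_potential_heat n μ hG
  have h1 : ∀ b : ℝ, 0 < b →
      ∫⁻ t, (∫⁻ y, G y * potential (heat n (b⁻¹ * t)) μ y) ∂(gam C s 1)
        ≤ gam C s 1 univ * K := by
    intro b hb
    have h2 := hK b hb
    rw [lintegral_mul_potential_heatMix n _ μ hG, lintegral_gam_scale C s hb hD] at h2
    have h3 := lintegral_gam_scale C s hb (g := fun _ => 1) measurable_const
    simp only [lintegral_const, one_mul] at h3
    rw [h3, mul_assoc] at h2
    refine (ENNReal.mul_le_mul_iff_right ?_ ENNReal.ofReal_ne_top).1 h2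
    rw [ne_eq, ENNReal.ofReal_eq_zero, not_le]
    positivity
  have h4 : gam C s 1 univ * ∫⁻ x, G x ∂μ ≤ gam C s 1 univ * K := by
    have hbound : ∀ᵐ t ∂(gam C s 1), ∫⁻ x, G x ∂μ
        ≤ liminf (fun k : ℕ => ∫⁻ y, G y * potential (heat n (((k : ℝ) + 1)⁻¹ * t)) μ y) atTop := by
      filter_upwards [ae_pos_gam C s 1] with t ht
      have hlim : Tendsto (fun k : ℕ => ((k : ℝ) + 1)⁻¹ * t) atTop (𝓝[>] 0) := by
        refine tendsto_nhdsWithin_iff.2 ⟨?_, Eventually.of_forall fun k => ?_⟩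
        · have := (tendsto_one_div_add_atTop_nhds_zero_nat (𝕜 := ℝ)).mul_const t
          simpa using this
        · exact mul_pos (by positivity) ht
      exact (le_liminf_lintegral_mul_potential_heat n μ hG hlsc).trans (hlim.liminf_le_liminf_comp)
    calc gam C s 1 univ * ∫⁻ x, G x ∂μ = ∫⁻ t, (∫⁻ x, G x ∂μ) ∂(gam C s 1) := by
          rw [lintegral_const, mul_comm]
      _ ≤ _ := lintegral_mono_ae hbound
      _ ≤ _ := lintegral_liminf_le fun k => hD.comp (measurable_const_mul _)
      _ ≤ liminf (fun k : ℕ => gam C s 1 univ * K) atTop :=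
          liminf_le_liminf (Eventually.of_forall fun k => h1 _ (by positivity))
      _ = _ := by simp
  refine (ENNReal.mul_le_mul_iff_right ?_ (gam_univ_lt_top hC hs one_pos).ne).1 h4
  have hG := Real.Gamma_pos_of_pos hs
  rw [gam_univ hC hs one_pos, ne_eq, ENNReal.ofReal_eq_zero, not_le]
  positivity

lemma min_le_add_mul_truncDiff {ε : ℝ≥0∞} (h0 : ε ≠ 0) (ht : ε ≠ ⊤) (u v : ℝ≥0∞) :
    min v (u + ε) ≤ u + ε * truncDiff ε⁻¹ u v := by
  have h : ε * truncDiff ε⁻¹ u v = min ε (v - u) := by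
    rw [truncDiff, mul_min, mul_one, ← mul_assoc, ENNReal.mul_inv_cancel h0 ht, one_mul]
  rw [h, ← min_add_add_left, min_comm]
  exact min_le_min le_rfl le_add_tsub

lemma min_add_le_liminf {ι : Type*} {l : Filter ι} [l.NeBot] {u v ε : ℝ≥0∞} {u' v' : ι → ℝ≥0∞}
    (hu : u ≤ liminf u' l) (hv : v ≤ liminf v' l) :
    min v (u + ε) ≤ liminf (fun i => min (v' i) (u' i + ε)) l := by
  rw [le_liminf_iff] at hu hv ⊢
  intro c hc
  obtain ⟨hc1, hc2⟩ := lt_min_iff.1 hc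
  have hu2 : ∀ᶠ i in l, c < u' i + ε := by
    rcases lt_or_ge c ε with hce | hce
    · exact Eventually.of_forall fun i => hce.trans_le le_add_self
    · filter_upwards [hu (c - ε) (ENNReal.sub_lt_of_lt_add hce hc2)] with i hi
      have hε : ε ≠ ⊤ := (hce.trans_lt (hc.trans_le le_top)).ne
      rw [← tsub_add_cancel_of_le hce]
      exact ENNReal.add_lt_add_right hε hi
  filter_upwards [hv c hc1, hu2] with i h1 h2 using lt_min h1 h2

lemma lintegral_min_potential_le (n : ℕ) {C s : ℝ} (hC : 0 < C) (hs : 0 < s) (hs1 : s ≤ 1)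
    (μ ν : Measure (Rn n)) [SFinite μ] [SFinite ν]
    (hμ : energy (heatMix n (gam C s 0)) μ < ⊤) (hν : energy (heatMix n (gam C s 0)) ν < ⊤)
    {ε : ℝ≥0∞} (h0 : ε ≠ 0) (ht : ε ≠ ⊤) :
    ∫⁻ x, min (potential (heatMix n (gam C s 0)) ν x)
        (potential (heatMix n (gam C s 0)) μ x + ε) ∂μ
      ≤ energy (heatMix n (gam C s 0)) μ + ε * ν univ := by
  have hu := measurable_potential_heatMix n (gam C s 0) μ
  have hv := measurable_potential_heatMix n (gam C s 0) ν
  refine lintegral_le_of_lintegral_gam_le n hC hs μ (hv.min (hu.add_const _)) ?_ ?_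
  · intro x y hy
    exact min_add_le_liminf (potential_heatMix_le_liminf n _ μ hy)
      (potential_heatMix_le_liminf n _ ν hy)
  · intro b hb
    have hw := measurable_potential_heatMix n (gam C s b) μ
    have h1 := lintegral_truncDiff_potential_le n hC hs hs1 hb μ ν hμ hν (N := ε⁻¹)
      (ENNReal.inv_ne_top.2 h0)
    have h2 := energy_conv_le n (gam C s b) (gam C s 0) (ae_pos_gam _ _ _) (ae_pos_gam _ _ _) μ
    unfold energy at h2
    rw [mutualEnergy_conv n _ _ (ae_pos_gam _ _ _) (ae_pos_gam _ _ _)] at h2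
    have hT : Measurable fun x => truncDiff ε⁻¹ (potential (heatMix n (gam C s 0)) μ x)
        (potential (heatMix n (gam C s 0)) ν x) * potential (heatMix n (gam C s b)) μ x :=
      (Measurable.truncDiff _ hu hv).mul hw
    calc _ ≤ ∫⁻ y, (potential (heatMix n (gam C s b)) μ y * potential (heatMix n (gam C s 0)) μ y
          + ε * (truncDiff ε⁻¹ (potential (heatMix n (gam C s 0)) μ y)
            (potential (heatMix n (gam C s 0)) ν y) * potential (heatMix n (gam C s b)) μ y)) := by
          refine lintegral_mono fun y => ?_
          refine (mul_le_mul_left (min_le_add_mul_truncDiff h0 ht _ _) _).trans (le_of_eq ?_)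
          ring
      _ ≤ _ := by
          rw [lintegral_add_left (f := fun y => potential (heatMix n (gam C s b)) μ y
            * potential (heatMix n (gam C s 0)) μ y) (hw.mul hu), lintegral_const_mul _ hT, mul_add]
          refine add_le_add h2 ((mul_le_mul_right h1 ε).trans (le_of_eq ?_))
          ring

lemma potential_smul {X : Type*} [MeasurableSpace X] (κ : X → X → ℝ≥0∞) (c : ℝ≥0∞)
    (μ : Measure X) (x : X) : potential κ (c • μ) x = c * potential κ μ x := by
  rw [potential, lintegral_smul_measure, smul_eq_mul, potential]

lemma lintegral_min_mul_potential_le (n : ℕ) {C s : ℝ} (hC : 0 < C) (hs : 0 < s) (hs1 : s ≤ 1)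
    (β ζ : Measure (Rn n)) [SFinite β] [SFinite ζ]
    (hβ : energy (heatMix n (gam C s 0)) β < ⊤) (hζ : energy (heatMix n (gam C s 0)) ζ < ⊤)
    (h : ∀ᵐ x ∂β, potential (heatMix n (gam C s 0)) β x = potential (heatMix n (gam C s 0)) ζ x)
    {δ ε : ℝ≥0∞} (hδ : δ ≠ ⊤) (h0 : ε ≠ 0) (ht : ε ≠ ⊤) :
    ∫⁻ x, min (δ * potential (heatMix n (gam C s 0)) β x) ε ∂β ≤ ε * ((1 + δ) * ζ univ) := by
  have hu := measurable_potential_heatMix n (gam C s 0) β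
  have hν : energy (heatMix n (gam C s 0)) ((1 + δ) • ζ) < ⊤ := by
    unfold energy at hζ ⊢
    rw [mutualEnergy_eq_lintegral_potential] at hζ ⊢
    simp_rw [potential_smul]
    rw [lintegral_const_mul' _ _ (by finiteness), lintegral_smul_measure, smul_eq_mul]
    finiteness
  have h1 := lintegral_min_potential_le n hC hs hs1 β ((1 + δ) • ζ) hβ hν h0 ht
  have h2 : ∫⁻ x, min (potential (heatMix n (gam C s 0)) ((1 + δ) • ζ) x)
      (potential (heatMix n (gam C s 0)) β x + ε) ∂β
      = energy (heatMix n (gam C s 0)) β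
        + ∫⁻ x, min (δ * potential (heatMix n (gam C s 0)) β x) ε ∂β := by
    rw [energy, mutualEnergy_eq_lintegral_potential, ← lintegral_add_left hu]
    refine lintegral_congr_ae ?_
    filter_upwards [h] with x hx
    rw [potential_smul, ← hx, add_mul, one_mul, min_add_add_left]
  rw [h2, Measure.smul_apply, smul_eq_mul] at h1
  exact (ENNReal.add_le_add_iff_left hβ.ne).1 h1

lemma measure_univ_le_of_potential_eq (n : ℕ) {C s : ℝ} (hC : 0 < C) (hs : 0 < s) (hs1 : s ≤ 1)
    (hpos : ∀ x y, heatMix n (gam C s 0) x y ≠ 0)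
    (β ζ : Measure (Rn n)) [SFinite β] [SFinite ζ]
    (hβ : energy (heatMix n (gam C s 0)) β < ⊤) (hζ : energy (heatMix n (gam C s 0)) ζ < ⊤)
    (h : ∀ᵐ x ∂β, potential (heatMix n (gam C s 0)) β x = potential (heatMix n (gam C s 0)) ζ x)
    (hζ1 : ζ univ ≤ 1) : β univ ≤ ζ univ := by
  rcases eq_or_ne β 0 with rfl | hβ0
  · simp
  have hu := measurable_potential_heatMix n (gam C s 0) β
  have hu0 : ∀ x, potential (heatMix n (gam C s 0)) β x ≠ 0 := by
    intro x hx
    rw [potential, lintegral_eq_zero_iff (measurable_heatMix_right n _ x)] at hx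
    refine hβ0 (ae_eq_bot.1 (eventually_false_iff_eq_bot.1 ?_))
    filter_upwards [hx] with y hy using hpos x y hy
  refine ENNReal.le_of_forall_pos_le_add fun δ hδ _ => ?_
  have hδ0 : (δ : ℝ≥0∞) ≠ 0 := by simpa using hδ.ne'
  have h1 : ∀ k : ℕ, ∫⁻ x, min ((k + 1 : ℝ≥0∞) * (δ * potential (heatMix n (gam C s 0)) β x)) 1 ∂β
      ≤ (1 + δ) * ζ univ := by
    intro k
    have hk0 : (k + 1 : ℝ≥0∞) ≠ 0 := by simp
    have hkt : (k + 1 : ℝ≥0∞) ≠ ⊤ := by finiteness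
    have h2 := lintegral_min_mul_potential_le n hC hs hs1 β ζ hβ hζ h (δ := δ)
      (ε := (k + 1 : ℝ≥0∞)⁻¹) ENNReal.coe_ne_top (ENNReal.inv_ne_zero.2 hkt)
      (ENNReal.inv_ne_top.2 hk0)
    have h3 := mul_le_mul_right h2 (k + 1 : ℝ≥0∞)
    rw [← mul_assoc, ENNReal.mul_inv_cancel hk0 hkt, one_mul, ← lintegral_const_mul' _ _ hkt] at h3
    simpa only [mul_min, ENNReal.mul_inv_cancel hk0 hkt] using h3
  calc β univ = ∫⁻ _, 1 ∂β := by simp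
    _ ≤ ∫⁻ x, liminf (fun k : ℕ =>
          min ((k + 1 : ℝ≥0∞) * (δ * potential (heatMix n (gam C s 0)) β x)) 1) atTop ∂β := by
        refine lintegral_mono fun x => ?_
        refine le_liminf_of_le (by isBoundedDefault) ?_
        have hlim : Tendsto (fun k : ℕ => (k : ℝ≥0∞) * (δ * potential (heatMix n (gam C s 0)) β x))
            atTop (𝓝 (⊤ * (δ * potential (heatMix n (gam C s 0)) β x))) :=
          ENNReal.Tendsto.mul_const ENNReal.tendsto_nat_nhds_top (Or.inl ENNReal.top_ne_zero)
        rw [ENNReal.top_mul (mul_ne_zero hδ0 (hu0 x))] at hlim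
        filter_upwards [hlim.eventually (lt_mem_nhds (show (1 : ℝ≥0∞) < ⊤ by simp))] with k hk
        refine le_min (hk.le.trans ?_) le_rfl
        gcongr
        exact le_self_add
    _ ≤ _ := lintegral_liminf_le fun k => ((hu.const_mul _).const_mul _).min measurable_const
    _ ≤ liminf (fun _ : ℕ => (1 + (δ : ℝ≥0∞)) * ζ univ) atTop :=
        liminf_le_liminf (Eventually.of_forall h1)
    _ = ζ univ + δ * ζ univ := by rw [liminf_const]; ring
    _ ≤ ζ univ + δ := by
        gcongr
        exact mul_le_of_le_one_right' hζ1

lemma measurable_potential_heat_right (n : ℕ) (t : ℝ) (μ : Measure (Rn n)) [SFinite μ] :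
    Measurable (potential (heat n t) μ) := by
  have := measurable_potential_heatMix n (Measure.dirac t) μ
  unfold potential at this ⊢
  simpa only [heatMix_dirac] using this

lemma heatEnergy_half (n : ℕ) {t : ℝ} (ht : 0 < t) (μ ν : Measure (Rn n)) [SFinite μ] [SFinite ν] :
    heatEnergy n μ ν t
      = ∫⁻ y, potential (heat n (t / 2)) μ y * potential (heat n (t / 2)) ν y := by
  have h := heatEnergy_add n (half_pos ht) (half_pos ht) μ ν
  rwa [add_halves] at h

lemma heatEnergy_self (n : ℕ) {t : ℝ} (ht : 0 < t) (μ : Measure (Rn n)) [SFinite μ] :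
    heatEnergy n μ μ t = ∫⁻ y, potential (heat n (t / 2)) μ y ^ 2 := by
  simp_rw [heatEnergy_half n ht, pow_two]

lemma two_mul_heatEnergy_le (n : ℕ) {t : ℝ} (ht : 0 < t) (μ ν : Measure (Rn n))
    [SFinite μ] [SFinite ν] :
    2 * heatEnergy n μ ν t ≤ heatEnergy n μ μ t + heatEnergy n ν ν t := by
  rw [heatEnergy_self n ht, heatEnergy_self n ht, heatEnergy_half n ht,
    ← lintegral_add_left ((measurable_potential_heat_right n _ μ).pow_const 2),
    ← lintegral_const_mul' _ _ (by simp)]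
  exact lintegral_mono fun y => two_mul_le_add_sq_ennreal _ _

lemma two_mul_mutualEnergy_le (n : ℕ) (m : Measure ℝ) [SFinite m] (hm : ∀ᵐ t ∂m, 0 < t)
    (μ ν : Measure (Rn n)) [SFinite μ] [SFinite ν] :
    2 * mutualEnergy (heatMix n m) μ ν ≤ energy (heatMix n m) μ + energy (heatMix n m) ν := by
  unfold energy
  simp_rw [mutualEnergy_heatMix]
  rw [← lintegral_add_left (measurable_heatEnergy n μ μ), ← lintegral_const_mul' _ _ (by simp)]
  refine lintegral_mono_ae ?_
  filter_upwards [hm] with t ht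
  exact two_mul_heatEnergy_le n ht μ ν

lemma eq_of_two_mul_eq_add_sq {a b : ℝ≥0∞} (ha : a ≠ ⊤) (hb : b ≠ ⊤)
    (h : 2 * (a * b) = a ^ 2 + b ^ 2) : a = b := by
  lift a to NNReal using ha
  lift b to NNReal using hb
  norm_cast at h ⊢
  have h' : 2 * ((a : ℝ) * b) = a ^ 2 + b ^ 2 := by exact_mod_cast h
  have : ((a : ℝ) - b) ^ 2 = 0 := by linarith
  exact_mod_cast sub_eq_zero.1 (pow_eq_zero_iff two_ne_zero |>.1 this)

lemma ae_potential_heat_eq (n : ℕ) {t : ℝ} (ht : 0 < t) (μ ν : Measure (Rn n))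
    [SFinite μ] [SFinite ν] (hμ : heatEnergy n μ μ t < ⊤) (hν : heatEnergy n ν ν t < ⊤)
    (h : heatEnergy n μ μ t + heatEnergy n ν ν t ≤ 2 * heatEnergy n μ ν t) :
    potential (heat n (t / 2)) μ =ᵐ[volume] potential (heat n (t / 2)) ν := by
  have hu := measurable_potential_heat_right n (t / 2) μ
  have hv := measurable_potential_heat_right n (t / 2) ν
  rw [heatEnergy_self n ht] at hμ hν
  rw [heatEnergy_self n ht, heatEnergy_self n ht, heatEnergy_half n ht,
    ← lintegral_add_left (hu.pow_const 2), ← lintegral_const_mul' _ _ (by simp)] at h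
  have hfin : ∫⁻ y, 2 * (potential (heat n (t / 2)) μ y * potential (heat n (t / 2)) ν y) ≠ ⊤ := by
    refine ne_top_of_le_ne_top (ENNReal.add_lt_top.2 ⟨hμ, hν⟩).ne ?_
    rw [← lintegral_add_left (hu.pow_const 2)]
    exact lintegral_mono fun y => two_mul_le_add_sq_ennreal _ _
  have h2 := ae_eq_of_ae_le_of_lintegral_le
    (Eventually.of_forall fun y => two_mul_le_add_sq_ennreal (potential (heat n (t / 2)) μ y)
      (potential (heat n (t / 2)) ν y)) hfin
    ((hu.pow_const 2).add (hv.pow_const 2)).aemeasurable h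
  filter_upwards [h2, ae_lt_top (hu.pow_const 2) hμ.ne, ae_lt_top (hv.pow_const 2) hν.ne]
    with y h3 h4 h5
  exact eq_of_two_mul_eq_add_sq (by rintro h; simp [h] at h4) (by rintro h; simp [h] at h5) h3

lemma frequently_of_ae_gam {C s : ℝ} (hC : 0 < C) {P : ℝ → Prop}
    (h : ∀ᵐ t ∂(gam C s 0), P t) : ∃ᶠ t in 𝓝[>] 0, P t := by
  rw [gam, ae_withDensity_iff (measurable_gam_density _ _ _),
    ae_restrict_iff' measurableSet_Ioi] at h
  intro hn
  obtain ⟨u, hu, hsub⟩ := (mem_nhdsGT_iff_exists_Ioo_subset).1 hn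
  have h1 : volume (Ioo 0 u) = 0 := by
    refine measure_mono_null (fun t ht => ?_) h
    intro hP
    refine hsub ht (hP ht.1 ?_)
    have ht0 : 0 < t := ht.1
    rw [ne_eq, ENNReal.ofReal_eq_zero, not_le]
    positivity
  rw [Real.volume_Ioo, ENNReal.ofReal_eq_zero, sub_zero] at h1
  exact absurd hu (not_lt.2 h1)

lemma tendsto_lintegral_heat (n : ℕ) (μ : Measure (Rn n)) [IsFiniteMeasure μ]
    (f : BoundedContinuousFunction (Rn n) NNReal) :
    Tendsto (fun t => ∫⁻ y, f y * potential (heat n t) μ y) (𝓝[>] 0) (𝓝 (∫⁻ x, f x ∂μ)) := by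
  have hf : Measurable fun x => (f x : ℝ≥0∞) := f.continuous.measurable.coe_nnreal_ennreal
  have hm1 : Measurable (heat n 1 0) :=
    (measurable_heat_right n 0).comp (measurable_const.prodMk measurable_id)
  obtain ⟨M, hM⟩ : ∃ M : NNReal, ∀ x, f x ≤ M :=
    ⟨nndist f 0, fun x => BoundedContinuousFunction.NNReal.upper_bound f x⟩
  simp_rw [lintegral_mul_potential_heat n _ μ hf]
  have hle : ∀ x, ∀ t : ℝ, 0 < t → ∫⁻ y, heat n t x y * f y ≤ M := by
    intro x t ht
    have h1 : Measurable (heat n t x) :=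
      (measurable_heat_right n x).comp (measurable_const.prodMk measurable_id)
    calc ∫⁻ y, heat n t x y * f y ≤ ∫⁻ y, heat n t x y * M := by
          refine lintegral_mono fun y => ?_
          gcongr
          exact hM y
      _ = M := by rw [lintegral_mul_const _ h1, lintegral_heat n ht, one_mul]
  refine tendsto_lintegral_filter_of_dominated_convergence (fun _ => (M : ℝ≥0∞))
    (Eventually.of_forall fun t => ?_) ?_ ?_ (Eventually.of_forall fun x => ?_)
  · refine Measurable.lintegral_prod_right'
      (f := fun p : Rn n × Rn n => heat n t p.1 p.2 * f p.2) ?_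
    exact ((measurable_heat n).comp (measurable_const.prodMk measurable_id)).mul
      (hf.comp measurable_snd)
  · filter_upwards [self_mem_nhdsWithin] with t ht
    exact Eventually.of_forall fun x => hle x t ht
  · rw [lintegral_const]
    finiteness
  · have h2 : Tendsto (fun t => ∫⁻ z, heat n 1 0 z * f (x + Real.sqrt t • z)) (𝓝[>] 0)
        (𝓝 (∫⁻ z, heat n 1 0 z * f x)) := by
      refine tendsto_lintegral_filter_of_dominated_convergence (fun z => heat n 1 0 z * M)
        (Eventually.of_forall fun t => ?_) (Eventually.of_forall fun t =>
          Eventually.of_forall fun z => ?_) ?_ (Eventually.of_forall fun z => ?_)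
      · exact hm1.mul (hf.comp ((measurable_const_smul (Real.sqrt t)).const_add x))
      · gcongr
        exact hM _
      · rw [lintegral_mul_const _ hm1, lintegral_heat n one_pos, one_mul]
        exact ENNReal.coe_ne_top
      · refine ENNReal.Tendsto.const_mul ?_ (Or.inr (heat_lt_top n 1 0 z).ne)
        rw [ENNReal.tendsto_coe]
        have h : Continuous fun t : ℝ => f (x + Real.sqrt t • z) := by fun_prop
        have := h.tendsto 0
        simp only [Real.sqrt_zero, zero_smul, add_zero] at this
        exact this.mono_left nhdsWithin_le_nhds
    rw [lintegral_mul_const _ hm1, lintegral_heat n one_pos, one_mul] at h2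
    refine h2.congr' ?_
    filter_upwards [self_mem_nhdsWithin] with t ht
    exact (lintegral_heat_mul_eq n ht x hf).symm

lemma eq_of_energy_add_le (n : ℕ) {C s : ℝ} (hC : 0 < C) (μ ν : Measure (Rn n))
    [IsFiniteMeasure μ] [IsFiniteMeasure ν] (hμ : energy (heatMix n (gam C s 0)) μ < ⊤)
    (hν : energy (heatMix n (gam C s 0)) ν < ⊤)
    (h : energy (heatMix n (gam C s 0)) μ + energy (heatMix n (gam C s 0)) ν
      ≤ 2 * mutualEnergy (heatMix n (gam C s 0)) μ ν) : μ = ν := by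
  have hE := fun μ ν : Measure (Rn n) => fun [SFinite μ] [SFinite ν] => measurable_heatEnergy n μ ν
  have hfin : 2 * mutualEnergy (heatMix n (gam C s 0)) μ ν ≠ ⊤ :=
    ne_top_of_le_ne_top (ENNReal.add_lt_top.2 ⟨hμ, hν⟩).ne
      (two_mul_mutualEnergy_le n _ (ae_pos_gam _ _ _) μ ν)
  unfold energy at hμ hν h
  simp only [mutualEnergy_heatMix] at hμ hν h hfin
  rw [← lintegral_add_left (hE μ μ), ← lintegral_const_mul' _ _ (by simp)] at h
  rw [← lintegral_const_mul' _ _ (by simp)] at hfin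
  have h2 := ae_eq_of_ae_le_of_lintegral_le
    (show ∀ᵐ t ∂(gam C s 0), _ from (ae_pos_gam C s 0).mono fun t ht =>
      two_mul_heatEnergy_le n ht μ ν) hfin ((hE μ μ).add (hE ν ν)).aemeasurable h
  have h3 : ∀ᵐ t ∂(gam C s 0),
      potential (heat n (t / 2)) μ =ᵐ[volume] potential (heat n (t / 2)) ν := by
    filter_upwards [h2, ae_pos_gam C s 0, ae_lt_top (hE μ μ) hμ.ne, ae_lt_top (hE ν ν) hν.ne]
      with t h4 ht h5 h6
    exact ae_potential_heat_eq n ht μ ν h5 h6 h4.ge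
  obtain ⟨t, ht, hP⟩ := exists_seq_forall_of_frequently (frequently_of_ae_gam hC h3)
  refine ext_of_forall_lintegral_eq_of_IsFiniteMeasure fun f => ?_
  have hhalf : Tendsto (fun k => t k / 2) atTop (𝓝[>] 0) := by
    rw [tendsto_nhdsWithin_iff] at ht ⊢
    refine ⟨by simpa using ht.1.div_const 2, ht.2.mono fun k hk => ?_⟩
    exact half_pos (show 0 < t k from hk)
  refine tendsto_nhds_unique ((tendsto_lintegral_heat n μ f).comp hhalf) ?_
  refine ((tendsto_lintegral_heat n ν f).comp hhalf).congr fun k => ?_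
  refine lintegral_congr_ae ?_
  filter_upwards [hP k] with y hy
  rw [hy]

lemma memEplus.sigmaFinite {n : ℕ} {κ : Rn n → Rn n → ℝ≥0∞} {μ : Measure (Rn n)}
    (h : memEplus κ μ) : SigmaFinite μ := by
  have : μ.Regular := h.1
  infer_instance

section

variable {n : ℕ} {m : Measure ℝ} [SFinite m]

lemma mutualEnergy_smul_left (c : ℝ≥0∞) (μ ν : Measure (Rn n)) [SFinite μ] [SFinite ν] :
    mutualEnergy (heatMix n m) (c • μ) ν = c * mutualEnergy (heatMix n m) μ ν := by
  rw [mutualEnergy_eq_lintegral_potential, mutualEnergy_eq_lintegral_potential,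
    lintegral_smul_measure, smul_eq_mul]

lemma mutualEnergy_add_left (μ μ' ν : Measure (Rn n)) [SFinite μ] [SFinite μ'] [SFinite ν] :
    mutualEnergy (heatMix n m) (μ + μ') ν
      = mutualEnergy (heatMix n m) μ ν + mutualEnergy (heatMix n m) μ' ν := by
  simp_rw [mutualEnergy_eq_lintegral_potential, lintegral_add_measure]

lemma mutualEnergy_mono_left {μ μ' : Measure (Rn n)} (ν : Measure (Rn n)) [SFinite μ] [SFinite μ']
    [SFinite ν] (h : μ ≤ μ') :
    mutualEnergy (heatMix n m) μ ν ≤ mutualEnergy (heatMix n m) μ' ν := by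
  simp_rw [mutualEnergy_eq_lintegral_potential]
  exact lintegral_mono' h le_rfl

lemma energy_smul (c : ℝ≥0∞) (μ : Measure (Rn n)) [SFinite μ] :
    energy (heatMix n m) (c • μ) = c * (c * energy (heatMix n m) μ) := by
  rw [energy, mutualEnergy_smul_left, mutualEnergy_comm, mutualEnergy_smul_left, energy]

lemma energy_mono {μ μ' : Measure (Rn n)} [SFinite μ] [SFinite μ'] (h : μ ≤ μ') :
    energy (heatMix n m) μ ≤ energy (heatMix n m) μ' := by
  refine (mutualEnergy_mono_left μ h).trans ?_
  rw [mutualEnergy_comm]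
  exact mutualEnergy_mono_left μ' h

lemma energy_add_smul (c : ℝ≥0∞) (β τ : Measure (Rn n)) [SFinite β] [SFinite τ] :
    energy (heatMix n m) (β + c • τ) = energy (heatMix n m) β
      + 2 * (c * mutualEnergy (heatMix n m) τ β) + c * (c * energy (heatMix n m) τ) := by
  rw [energy, mutualEnergy_add_left, mutualEnergy_comm n m β, mutualEnergy_add_left,
    mutualEnergy_comm n m (c • τ) (β + c • τ), mutualEnergy_add_left, mutualEnergy_smul_left,
    mutualEnergy_comm n m β (c • τ), mutualEnergy_smul_left, ← energy, ← energy, energy_smul]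
  ring

lemma ae_of_nearlyEverywhere {A : Set (Rn n)} {P : Rn n → Prop}
    (hP : MeasurableSet {x | ¬ P x}) (hne : NearlyEverywhere (heatMix n m) A P)
    {μ : Measure (Rn n)} (hμ : memEplus (heatMix n m) μ) (hA : Concentrated μ A) :
    ∀ᵐ x ∂μ, P x := by
  have hreg : μ.Regular := hμ.1
  have hsf := hμ.sigmaFinite
  rw [ae_iff]
  by_contra h0
  obtain ⟨K, hKP, hK, hK0⟩ := hP.exists_lt_isCompact (pos_iff_ne_zero.2 h0)
  have hKtop : μ K ≠ ⊤ := hK.measure_lt_top.ne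
  have hcap : wcap (heatMix n m) {x ∈ A | ¬ P x} = ⊤ := ENNReal.inv_eq_zero.1 hne
  have hfin : IsFiniteMeasure (μ.restrict K) := ⟨by simpa using hK.measure_lt_top⟩
  have hfin' : IsFiniteMeasure ((μ K)⁻¹ • μ.restrict K) :=
    Measure.smul_finite _ (ENNReal.inv_ne_top.2 hK0.ne')
  have hen : energy (heatMix n m) ((μ K)⁻¹ • μ.restrict K) < ⊤ := by
    rw [energy_smul]
    have h1 := (energy_mono (n := n) (m := m) (Measure.restrict_le_self (μ := μ) (s := K))).trans_lt
      hμ.2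
    have h2 : (μ K)⁻¹ ≠ ⊤ := ENNReal.inv_ne_top.2 hK0.ne'
    finiteness
  have hmem : memBreve (heatMix n m) {x ∈ A | ¬ P x} ((μ K)⁻¹ • μ.restrict K) := by
    refine ⟨⟨?_, hen⟩, fun L _ => ?_, ?_⟩
    · unfold IsRadon
      infer_instance
    · rw [Measure.smul_apply, Measure.restrict_apply' hK.measurableSet, smul_eq_mul]
      refine mul_eq_zero_of_right _ (measure_mono_null ?_ (hA K hK))
      rintro x ⟨⟨hx, -⟩, hxK⟩
      exact ⟨fun hxA => hx ⟨hxA, hKP hxK⟩, hxK⟩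
    · rw [Measure.smul_apply, Measure.restrict_apply_univ, smul_eq_mul,
        ENNReal.inv_mul_cancel hK0.ne' hKtop]
  have h3 : wcap (heatMix n m) {x ∈ A | ¬ P x}
      ≤ energy (heatMix n m) ((μ K)⁻¹ • μ.restrict K) := iInf₂_le _ hmem
  rw [hcap] at h3
  exact hen.not_ge h3

lemma mutualEnergy_lt_top (hm : ∀ᵐ t ∂m, 0 < t) {μ ν : Measure (Rn n)} [SFinite μ] [SFinite ν]
    (hμ : energy (heatMix n m) μ < ⊤) (hν : energy (heatMix n m) ν < ⊤) :
    mutualEnergy (heatMix n m) μ ν < ⊤ := by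
  have h := (two_mul_mutualEnergy_le n m hm μ ν).trans_lt (ENNReal.add_lt_top.2 ⟨hμ, hν⟩)
  exact lt_of_le_of_lt (le_mul_of_one_le_left' (by norm_num)) h

lemma ae_potential_eq {A : Set (Rn n)} {ζ β μ : Measure (Rn n)} [SFinite ζ] [SFinite β]
    (hβ : IsInnerBalayage (heatMix n m) A ζ β) (hμ : memEplus (heatMix n m) μ)
    (hA : Concentrated μ A) :
    ∀ᵐ x ∂μ, potential (heatMix n m) β x = potential (heatMix n m) ζ x :=
  ae_of_nearlyEverywhere (measurableSet_eq_fun (measurable_potential_heatMix n m β)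
    (measurable_potential_heatMix n m ζ)).compl hβ.2.2 hμ hA

lemma fieldIntegrable_and_gaussI_eq (hm : ∀ᵐ t ∂m, 0 < t) {A : Set (Rn n)}
    {ζ β μ : Measure (Rn n)} [SFinite ζ] [SFinite β] {f : Rn n → EReal}
    (hf : ∀ x, f x = -((potential (heatMix n m) ζ x : ℝ≥0∞) : EReal))
    (hβ : IsInnerBalayage (heatMix n m) A ζ β) (hμ : memEplus (heatMix n m) μ)
    (hA : Concentrated μ A) :
    FieldIntegrable f μ ∧ gaussI (heatMix n m) f μ
      = (energy (heatMix n m) μ).toReal - 2 * (mutualEnergy (heatMix n m) μ β).toReal := by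
  have hsf := hμ.sigmaFinite
  have hae := ae_potential_eq hβ hμ hA
  have hv := measurable_potential_heatMix n m β
  have hlt := mutualEnergy_lt_top hm hμ.2 hβ.1.2
  rw [mutualEnergy_eq_lintegral_potential] at hlt
  have hfin := ae_lt_top hv hlt.ne
  have hfeq : (fun x => (f x).toReal)
      =ᵐ[μ] fun x => -(potential (heatMix n m) β x).toReal := by
    filter_upwards [hae] with x hx
    rw [hf, EReal.toReal_neg_eq, EReal.toReal_coe_ennreal, hx]
  refine ⟨⟨?_, ?_⟩, ?_⟩
  · exact ((integrable_toReal_of_lintegral_ne_top hv.aemeasurable hlt.ne).neg).congr hfeq.symm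
  · filter_upwards [hae, hfin] with x hx hx'
    rw [hx] at hx'
    rw [hf, ne_eq, ne_eq, EReal.neg_eq_top_iff, EReal.neg_eq_bot_iff]
    refine ⟨EReal.coe_ennreal_ne_bot _, ?_⟩
    simpa using hx'.ne
  · rw [gaussI, fieldIntegral, integral_congr_ae hfeq, integral_neg,
      integral_toReal hv.aemeasurable hfin, mutualEnergy_eq_lintegral_potential]
    ring

lemma IsSolution.gaussI_le {κ : Rn n → Rn n → ℝ≥0∞} {A : Set (Rn n)} {f : Rn n → EReal}
    {l μ : Measure (Rn n)} (hl : IsSolution κ A f l) (hμ : Admissible κ A f μ) :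
    gaussI κ f l ≤ gaussI κ f μ := by
  have h : ((gaussI κ f l : ℝ) : EReal) ≤ ((gaussI κ f μ : ℝ) : EReal) := by
    rw [hl.2]
    exact iInf₂_le μ hμ
  exact_mod_cast h

lemma isSolution_of_measure_univ_eq_one (hm : ∀ᵐ t ∂m, 0 < t) {A : Set (Rn n)}
    {ζ β : Measure (Rn n)} [SFinite ζ] [SFinite β] {f : Rn n → EReal}
    (hf : ∀ x, f x = -((potential (heatMix n m) ζ x : ℝ≥0∞) : EReal))
    (hβ : IsInnerBalayage (heatMix n m) A ζ β) (h1 : β univ = 1) :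
    IsSolution (heatMix n m) A f β := by
  obtain ⟨hi, hg⟩ := fieldIntegrable_and_gaussI_eq hm hf hβ hβ.1 hβ.2.1
  have hadm : Admissible (heatMix n m) A f β := ⟨⟨hβ.1, hβ.2.1, h1⟩, hi⟩
  refine ⟨hadm, le_antisymm (le_iInf₂ fun μ hμ => ?_) (iInf₂_le β hadm)⟩
  have hsf := hμ.1.1.sigmaFinite
  rw [EReal.coe_le_coe_iff, hg, (fieldIntegrable_and_gaussI_eq hm hf hβ hμ.1.1 hμ.1.2.1).2]
  have hle := ENNReal.toReal_mono (ENNReal.add_lt_top.2 ⟨hμ.1.1.2, hβ.1.2⟩).ne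
    (two_mul_mutualEnergy_le n m hm μ β)
  rw [ENNReal.toReal_add hμ.1.1.2.ne hβ.1.2.ne, ENNReal.toReal_mul, ENNReal.toReal_ofNat] at hle
  have hββ : mutualEnergy (heatMix n m) β β = energy (heatMix n m) β := rfl
  rw [hββ]
  linarith

lemma IsSolution.energy_add_le (hm : ∀ᵐ t ∂m, 0 < t) {A : Set (Rn n)}
    {ζ β l : Measure (Rn n)} [SFinite ζ] [IsFiniteMeasure β] {f : Rn n → EReal}
    (hf : ∀ x, f x = -((potential (heatMix n m) ζ x : ℝ≥0∞) : EReal))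
    (hβ : IsInnerBalayage (heatMix n m) A ζ β) (h1 : β univ ≤ 1)
    (hcap : innerCap (heatMix n m) A = ⊤) (hl : IsSolution (heatMix n m) A f l) :
    energy (heatMix n m) l + energy (heatMix n m) β ≤ 2 * mutualEnergy (heatMix n m) l β := by
  have hsf := hl.1.1.1.sigmaFinite
  have hw : wcap (heatMix n m) A = 0 := ENNReal.inv_eq_top.1 hcap
  have hmut := mutualEnergy_lt_top hm hl.1.1.1.2 hβ.1.2
  have key : ∀ δ : ℝ, 0 < δ → gaussI (heatMix n m) f l
      ≤ -(energy (heatMix n m) β).toReal + δ := by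
    intro δ hδ
    have h2 : wcap (heatMix n m) A < ENNReal.ofReal δ := by rw [hw]; simpa using hδ
    obtain ⟨τ, hτ⟩ := iInf_lt_iff.1 h2
    obtain ⟨hτm, hτ⟩ := iInf_lt_iff.1 hτ
    have hτfin : IsFiniteMeasure τ := ⟨by rw [hτm.2.2]; exact one_lt_top⟩
    obtain ⟨c, hc⟩ : ∃ c, c = 1 - β univ := ⟨_, rfl⟩
    have hc1 : c ≤ 1 := hc ▸ tsub_le_self
    have hct : c ≠ ⊤ := ne_top_of_le_ne_top one_ne_top hc1
    have hcfin : IsFiniteMeasure (c • τ) := Measure.smul_finite _ hct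
    have hmutτ := mutualEnergy_lt_top hm hτm.1.2 hβ.1.2
    have hE := energy_add_smul (m := m) c β τ
    have hM : mutualEnergy (heatMix n m) (β + c • τ) β
        = energy (heatMix n m) β + c * mutualEnergy (heatMix n m) τ β := by
      rw [mutualEnergy_add_left, mutualEnergy_smul_left, energy]
    have hβE := hβ.1.2
    have hτE := hτm.1.2
    have hF2 : 2 * (c * mutualEnergy (heatMix n m) τ β) ≠ ⊤ :=
      ENNReal.mul_ne_top (by simp) (ENNReal.mul_ne_top hct hmutτ.ne)
    have hF3 : c * (c * energy (heatMix n m) τ) ≠ ⊤ :=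
      ENNReal.mul_ne_top hct (ENNReal.mul_ne_top hct hτE.ne)
    have hF1 := ENNReal.add_ne_top.2 ⟨hβE.ne, hF2⟩
    have hmem : memEplus (heatMix n m) (β + c • τ) := by
      refine ⟨?_, ?_⟩
      · unfold IsRadon
        infer_instance
      · rw [hE]
        exact ENNReal.add_lt_top.2 ⟨hF1.lt_top, hF3.lt_top⟩
    have hconc : Concentrated (β + c • τ) A := by
      intro K hK
      rw [Measure.add_apply, Measure.smul_apply, hβ.2.1 K hK, hτm.2.1 K hK, smul_zero, add_zero]
    obtain ⟨hi, hg⟩ := fieldIntegrable_and_gaussI_eq hm hf hβ hmem hconc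
    have huniv : (β + c • τ) univ = 1 := by
      rw [Measure.add_apply, Measure.smul_apply, hτm.2.2, smul_eq_mul, mul_one, hc,
        add_tsub_cancel_of_le h1]
    refine (hl.gaussI_le ⟨⟨hmem, hconc, huniv⟩, hi⟩).trans ?_
    have hcδ : (c * (c * energy (heatMix n m) τ)).toReal ≤ δ := by
      refine ENNReal.toReal_le_of_le_ofReal hδ.le (le_trans ?_ hτ.le)
      exact (mul_le_of_le_one_left' hc1).trans (mul_le_of_le_one_left' hc1)
    rw [hg, hE, hM, ENNReal.toReal_add hF1 hF3, ENNReal.toReal_add hβE.ne hF2,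
      ENNReal.toReal_add hβE.ne (ENNReal.mul_ne_top hct hmutτ.ne), ENNReal.toReal_mul (a := 2),
      ENNReal.toReal_ofNat]
    linarith
  have h3 := le_of_forall_pos_le_add key
  rw [(fieldIntegrable_and_gaussI_eq hm hf hβ hl.1.1.1 hl.1.1.2.1).2] at h3
  have hlE := hl.1.1.1.2
  have hβE := hβ.1.2
  rw [← ENNReal.toReal_le_toReal (ENNReal.add_ne_top.2 ⟨hlE.ne, hβE.ne⟩)
      (ENNReal.mul_ne_top (by simp) hmut.ne), ENNReal.toReal_add hlE.ne hβE.ne, ENNReal.toReal_mul, ENNReal.toReal_ofNat]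
  linarith

end

lemma rieszKernel_ne_zero (n : ℕ) (α : ℝ) (x y : Rn n) (hα : α < n) : rieszKernel n α x y ≠ 0 := by
  rw [rieszKernel, ne_eq, ENNReal.rpow_eq_zero_iff]
  rintro (⟨-, h⟩ | ⟨h, -⟩)
  · linarith
  · exact ENNReal.ofReal_ne_top h

theorem stmt12 (n : ℕ) (hn : 2 ≤ n) (α : ℝ) (hα0 : 0 < α) (hαn : α < n) (hα2 : α ≤ 2)
    (A : Set (Rn n)) (ζ β : Measure (Rn n)) (f : Rn n → EReal)
    (hclosed : StrongClosedEplusOn (rieszKernel n α) A)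
    (hcapinf : innerCap (rieszKernel n α) A = ⊤)
    (hcap0 : innerCap (rieszKernel n α) A ≠ 0)
    (hζ : memEplus (rieszKernel n α) ζ) (hζ1 : ζ Set.univ ≤ 1)
    (hf : ∀ x, f x = -((potential (rieszKernel n α) ζ x : ℝ≥0∞) : EReal))
    (hβ : IsInnerBalayage (rieszKernel n α) A ζ β) :
    ((∃ l : Measure (Rn n), IsSolution (rieszKernel n α) A f l) ↔ β Set.univ = 1) ∧
    ∀ l : Measure (Rn n), IsSolution (rieszKernel n α) A f l → l = β := by
  obtain ⟨C, hC, hκ⟩ := exists_rieszKernel_eq_heatMix n α hαn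
  have hpos := fun x y => rieszKernel_ne_zero n α x y hαn
  simp only [hκ] at hcapinf hζ hf hβ hpos ⊢
  have hm := ae_pos_gam C (α / 2) 0
  have hβs := hβ.1.sigmaFinite
  have hζs := hζ.sigmaFinite
  have hs : 0 < α / 2 := by positivity
  have hβ1 : β univ ≤ 1 := (measure_univ_le_of_potential_eq n hC hs (by linarith) hpos β ζ
    hβ.1.2 hζ.2 (ae_potential_eq hβ hβ.1 hβ.2.1) hζ1).trans hζ1
  have hβfin : IsFiniteMeasure β := ⟨hβ1.trans_lt one_lt_top⟩
  have huniq : ∀ l, IsSolution (heatMix n (gam C (α / 2) 0)) A f l → l = β := by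
    intro l hl
    have hlfin : IsFiniteMeasure l := ⟨by rw [hl.1.1.2.2]; exact one_lt_top⟩
    exact eq_of_energy_add_le n hC l β hl.1.1.1.2 hβ.1.2 (hl.energy_add_le hm hf hβ hβ1 hcapinf)
  refine ⟨⟨fun ⟨l, hl⟩ => ?_, fun h1 => ⟨β, isSolution_of_measure_univ_eq_one hm hf hβ h1⟩⟩, huniq⟩
  rw [← huniq l hl]
  exact hl.1.1.2.2

end GaussVar
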